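/- For every h ∈ ℝ, the Parisi functional 𝒫_{ξ,h}(μ) = Φ_μ(0,h) is strictly convex on 𝓜: for any two distinct measures μ₀, μ₁ ∈ 𝓜 and any λ ∈ (0,1), Φ_{(1−λ)μ₀+λμ₁}(0,h) < (1−λ)Φ_{μ₀}(0,h) + λΦ_{μ₁}(0,h). -/

import Mathlib

open MeasureTheory ProbabilityTheory Real Set Filter

noncomputable section

/-- `ξ(s) = ∑_{p≥2} β_p² s^p` (we use `β : ℕ → ℝ` with `β 0 = β 1 = 0`). -/
def xiFn (β : ℕ → ℝ) (s : ℝ) : ℝ := ∑' p : ℕ, β p ^ 2 * s ^ p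

/-- `ξ'(s)`. -/
def xiD (β : ℕ → ℝ) (s : ℝ) : ℝ := ∑' p : ℕ, (p : ℝ) * β p ^ 2 * s ^ (p - 1)

/-- `ζ(s) = ξ''(s)`. -/
def zetaFn (β : ℕ → ℝ) (s : ℝ) : ℝ :=
  ∑' p : ℕ, (p : ℝ) * ((p : ℝ) - 1) * β p ^ 2 * s ^ (p - 2)

/-- admissible sequence of temperature parameters -/
def ValidBeta (β : ℕ → ℝ) : Prop :=
  β 0 = 0 ∧ β 1 = 0 ∧ (∀ p, 0 ≤ β p) ∧ (∃ p, 2 ≤ p ∧ 0 < β p) ∧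
    Summable fun p : ℕ => (2 : ℝ) ^ p * β p ^ 2

/-- membership in `𝓜`: a Borel probability measure concentrated on `[0,1]` -/
def MemM (μ : Measure ℝ) : Prop := IsProbabilityMeasure μ ∧ μ (Icc (0 : ℝ) 1)ᶜ = 0

/-- member of `𝓜_d`: finitely supported -/
def FinSupp (μ : Measure ℝ) : Prop := ∃ S : Finset ℝ, μ ((S : Set ℝ))ᶜ = 0

/-- the distribution function `α(s) = μ([0,s])` -/
def distF (μ : Measure ℝ) (s : ℝ) : ℝ := (μ (Icc 0 s)).toReal

/-- the metric `d(μ,ν) = ∫_0^1 |μ([0,s]) - ν([0,s])| ds` -/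
def dM (μ ν : Measure ℝ) : ℝ := ∫ s in (0 : ℝ)..1, |distF μ s - distF ν s|

/-- the smallest atom of `μ` strictly after `s` (or `1` if there is none) -/
def nextPt (μ : Measure ℝ) (s : ℝ) : ℝ :=
  sInf ({q : ℝ | s < q ∧ q ≤ 1 ∧ μ {q} ≠ 0} ∪ {1})

/-- one step of the backward recursion defining the Parisi PDE solution:
`(1/m) log E exp (m Φ(t, x + z √(ξ'(t) - ξ'(s))))`, interpreted as
`E Φ(t, x + z √(ξ'(t) - ξ'(s)))` when `m = 0`. -/
def gStep (β : ℕ → ℝ) (Φ : ℝ → ℝ → ℝ) (m t s x : ℝ) : ℝ :=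
  if m = 0 then ∫ z, Φ t (x + z * Real.sqrt (xiD β t - xiD β s)) ∂(gaussianReal 0 1)
  else m⁻¹ * Real.log
    (∫ z, Real.exp (m * Φ t (x + z * Real.sqrt (xiD β t - xiD β s))) ∂(gaussianReal 0 1))

/-- `Φ` is the Parisi PDE solution of a finitely supported `μ`. -/
def IsAtomicSol (β : ℕ → ℝ) (μ : Measure ℝ) (Φ : ℝ → ℝ → ℝ) : Prop :=
  (∀ x : ℝ, Φ 1 x = Real.log (Real.cosh x)) ∧
  (∀ s ∈ Ico (0 : ℝ) 1, ∀ x : ℝ, Φ s x = gStep β Φ (distF μ s) (nextPt μ s) s x)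

/-- `Φ` is the Parisi family `μ ↦ Φ_μ`: it satisfies the backward recursion on `𝓜_d`
and is `d`-continuous on `𝓜` (uniformly in `(s,x) ∈ [0,1] × ℝ`). -/
def IsParisiFamily (β : ℕ → ℝ) (Φ : Measure ℝ → ℝ → ℝ → ℝ) : Prop :=
  (∀ μ, MemM μ → FinSupp μ → IsAtomicSol β μ (Φ μ)) ∧
  (∀ μ, MemM μ → ∀ ε : ℝ, 0 < ε → ∃ δ : ℝ, 0 < δ ∧ ∀ ν, MemM ν → dM μ ν < δ →
      ∀ s ∈ Icc (0 : ℝ) 1, ∀ x : ℝ, |Φ μ s x - Φ ν s x| < ε)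

/-- `B` is a standard Brownian motion under `P`. -/
def IsStdBM {Ω : Type*} [MeasurableSpace Ω] (P : Measure Ω) (B : ℝ → Ω → ℝ) : Prop :=
  (∀ t : ℝ, Measurable (B t)) ∧
  (∀ᵐ ω ∂P, B 0 ω = 0) ∧
  (∀ᵐ ω ∂P, Continuous fun t => B t ω) ∧
  (∀ s t : ℝ, 0 ≤ s → s ≤ t →
    Measure.map (fun ω => B t ω - B s ω) P = gaussianReal 0 (Real.toNNReal (t - s))) ∧
  (∀ s t : ℝ, 0 ≤ s → s ≤ t →
    Indep (MeasurableSpace.comap (fun ω => B t ω - B s ω) inferInstance)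
      (⨆ v ∈ Icc (0 : ℝ) s, MeasurableSpace.comap (B v) inferInstance) P)

/-- the space `𝓓[s,t]`: progressively measurable processes bounded by `1` on `[s,t]` -/
def InD {Ω : Type*} {mΩ : MeasurableSpace Ω} (𝓕 : Filtration ℝ mΩ) (s t : ℝ)
    (u : ℝ → Ω → ℝ) : Prop :=
  ProgMeasurable 𝓕 u ∧ ∀ r ∈ Icc s t, ∀ ω, |u r ω| ≤ 1

/-- the norm `‖u‖ = (E ∫_s^t u(r)² dr)^{1/2}` on `𝓓[s,t]` -/
def normD {Ω : Type*} [MeasurableSpace Ω] (P : Measure Ω) (s t : ℝ)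
    (u : ℝ → Ω → ℝ) : ℝ :=
  Real.sqrt (∫ ω, (∫ r in s..t, (u r ω) ^ 2) ∂P)

/-- the functional
`F^{s,t}(u,x) = E[Φ_μ(t, x + ∫_s^t α ζ u dr + W(t) - W(s)) - (1/2)∫_s^t α ζ u² dr]`,
where `W r = B (ξ' r)`. -/
def Ffn {Ω : Type*} [MeasurableSpace Ω] (P : Measure Ω) (β : ℕ → ℝ) (μ : Measure ℝ)
    (Φ : ℝ → ℝ → ℝ) (W : ℝ → Ω → ℝ) (s t : ℝ) (u : ℝ → Ω → ℝ) (x : ℝ) : ℝ :=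
  ∫ ω, (Φ t (x + (∫ r in s..t, distF μ r * zetaFn β r * u r ω) + (W t ω - W s ω))
      - (1 / 2) * ∫ r in s..t, distF μ r * zetaFn β r * (u r ω) ^ 2) ∂P




abbrev gm : Measure ℝ := gaussianReal 0 1

/-- measurable with at most exponential growth -/
def EG (F : ℝ → ℝ) : Prop :=
  Measurable F ∧ ∃ C a : ℝ, 0 ≤ C ∧ 0 ≤ a ∧ ∀ z, |F z| ≤ C * exp (a * |z|)

lemma integrable_exp_abs (a : ℝ) : Integrable (fun z : ℝ => exp (a * |z|)) gm := by
  have h1 : Integrable (fun z : ℝ => exp (a * z) + exp ((-a) * z)) gm :=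
    (integrable_exp_mul_gaussianReal a).add (integrable_exp_mul_gaussianReal (-a))
  refine h1.mono' (by fun_prop) (Eventually.of_forall fun z => ?_)
  rw [Real.norm_eq_abs, abs_of_pos (exp_pos _)]
  rcases abs_cases z with ⟨h, _⟩ | ⟨h, _⟩ <;> rw [h]
  · linarith [exp_pos (-a * z)]
  · rw [show a * -z = -a * z by ring]; linarith [exp_pos (a * z)]

lemma EG.integrable {F : ℝ → ℝ} (hF : EG F) : Integrable F gm := by
  obtain ⟨hm, C, a, hC, ha, hb⟩ := hF
  refine ((integrable_exp_abs a).const_mul C).mono' hm.aestronglyMeasurable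
    (Eventually.of_forall fun z => ?_)
  simpa using hb z

lemma EG.const (c : ℝ) : EG (fun _ => c) :=
  ⟨measurable_const, |c|, 0, abs_nonneg _, le_rfl, fun z => by simp⟩

lemma EG.of_bdd {F : ℝ → ℝ} (hm : Measurable F) (C : ℝ) (h : ∀ z, |F z| ≤ C) : EG F :=
  ⟨hm, C, 0, (abs_nonneg _).trans (h 0), le_rfl, fun z => by simpa using h z⟩

lemma EG.mul {F G : ℝ → ℝ} (hF : EG F) (hG : EG G) : EG (fun z => F z * G z) := by
  obtain ⟨hm, C, a, hC, ha, hb⟩ := hF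
  obtain ⟨hm', C', a', hC', ha', hb'⟩ := hG
  refine ⟨hm.mul hm', C * C', a + a', by positivity, by positivity, fun z => ?_⟩
  rw [abs_mul, add_mul, exp_add]
  calc |F z| * |G z| ≤ (C * exp (a * |z|)) * (C' * exp (a' * |z|)) := by
        gcongr
        · exact hb z
        · exact hb' z
    _ = _ := by ring

lemma EG.add {F G : ℝ → ℝ} (hF : EG F) (hG : EG G) : EG (fun z => F z + G z) := by
  obtain ⟨hm, C, a, hC, ha, hb⟩ := hF
  obtain ⟨hm', C', a', hC', ha', hb'⟩ := hG
  refine ⟨hm.add hm', C + C', a + a', by positivity, by positivity, fun z => ?_⟩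
  have e1 : exp (a * |z|) ≤ exp ((a + a') * |z|) := by
    apply exp_le_exp.2; nlinarith [abs_nonneg z, mul_nonneg ha' (abs_nonneg z)]
  have e2 : exp (a' * |z|) ≤ exp ((a + a') * |z|) := by
    apply exp_le_exp.2; nlinarith [abs_nonneg z, mul_nonneg ha (abs_nonneg z)]
  calc |F z + G z| ≤ |F z| + |G z| := abs_add_le _ _
    _ ≤ C * exp (a * |z|) + C' * exp (a' * |z|) := add_le_add (hb z) (hb' z)
    _ ≤ C * exp ((a + a') * |z|) + C' * exp ((a + a') * |z|) := by gcongr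
    _ = _ := by ring

lemma EG.cmul {F : ℝ → ℝ} (c : ℝ) (hF : EG F) : EG (fun z => c * F z) := (EG.const c).mul hF

lemma EG.sub {F G : ℝ → ℝ} (hF : EG F) (hG : EG G) : EG (fun z => F z - G z) := by
  have := hF.add (hG.cmul (-1))
  simpa [sub_eq_add_neg] using this

lemma EG.sq {F : ℝ → ℝ} (hF : EG F) : EG (fun z => F z ^ 2) := by
  simpa [pow_two] using hF.mul hF

lemma EG.abs {F : ℝ → ℝ} (hF : EG F) : EG (fun z => |F z|) := by
  obtain ⟨hm, C, a, hC, ha, hb⟩ := hF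
  exact ⟨hm.abs, C, a, hC, ha, fun z => by simpa using hb z⟩

lemma EG.expabs {a : ℝ} (ha : 0 ≤ a) : EG (fun z => exp (a * |z|)) :=
  ⟨by fun_prop, 1, a, zero_le_one, ha, fun z => by rw [abs_of_pos (exp_pos _)]; simp⟩

lemma abs_le_exp_abs (z : ℝ) : |z| ≤ exp |z| := by linarith [add_one_le_exp |z|]

lemma sq_le_exp_abs (z : ℝ) : z ^ 2 ≤ 2 * exp |z| := by
  have := Real.quadratic_le_exp_of_nonneg (abs_nonneg z)
  rw [sq_abs] at this
  linarith [abs_nonneg z]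

lemma EG.id : EG (fun z => z) :=
  ⟨measurable_id, 1, 1, zero_le_one, zero_le_one, fun z => by simpa using abs_le_exp_abs z⟩

lemma EG.comp_affine {F : ℝ → ℝ} (hF : EG F) (x s : ℝ) : EG (fun z => F (x + z * s)) := by
  obtain ⟨hm, C, a, hC, ha, hb⟩ := hF
  refine ⟨hm.comp (by fun_prop), C * exp (a * |x|), a * |s|, by positivity, by positivity,
    fun z => (hb _).trans ?_⟩
  rw [mul_assoc, ← exp_add]
  gcongr
  calc a * |x + z * s| ≤ a * (|x| + |z| * |s|) := by
        gcongr; exact (abs_add_le _ _).trans (by rw [abs_mul])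
    _ = _ := by ring

lemma EG.exp_lip {F : ℝ → ℝ} (hm : Measurable F) (L : ℝ) (hL : 0 ≤ L)
    (h : ∀ z, |F z - F 0| ≤ L * |z|) : EG (fun z => exp (F z)) := by
  refine ⟨by fun_prop, exp (F 0), L, (exp_pos _).le, hL, fun z => ?_⟩
  rw [abs_of_pos (exp_pos _), ← exp_add]
  apply exp_le_exp.2
  linarith [h z, le_abs_self (F z - F 0)]

lemma EG.lip {F : ℝ → ℝ} (hm : Measurable F) (L : ℝ) (hL : 0 ≤ L)
    (h : ∀ z, |F z - F 0| ≤ L * |z|) : EG F := by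
  refine ⟨hm, |F 0| + L, 1, by positivity, zero_le_one, fun z => ?_⟩
  have h1 : |F z| ≤ |F 0| + L * |z| := by
    have := abs_add_le (F 0) (F z - F 0)
    rw [add_sub_cancel] at this
    linarith [h z]
  have h2 := abs_le_exp_abs z
  have h3 : 1 ≤ exp |z| := one_le_exp (abs_nonneg z)
  rw [one_mul]
  nlinarith [abs_nonneg (F 0)]

/-- shift of the standard Gaussian -/
lemma gm_shift (F : ℝ → ℝ) (θ : ℝ) :
    ∫ z, F z ∂gm = ∫ w, F (w + θ) * exp (-θ * w - θ ^ 2 / 2) ∂gm := by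
  rw [integral_gaussianReal_eq_integral_smul (by norm_num),
    integral_gaussianReal_eq_integral_smul (by norm_num),
    ← integral_add_right_eq_self _ θ]
  congr 1
  ext w
  simp only [gaussianPDFReal, smul_eq_mul]
  rw [show ∀ a b c d : ℝ, a * b * (c * d) = (a * (b * d)) * c by intros; ring, ← exp_add]
  congr 3
  push_cast
  ring

lemma hasDerivAt_gm {G G' : ℝ → ℝ} (hG : EG G) (hG' : EG G') (hd : ∀ y, HasDerivAt G (G' y) y)
    (s x : ℝ) :
    HasDerivAt (fun x => ∫ z, G (x + z * s) ∂gm) (∫ z, G' (x + z * s) ∂gm) x := by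
  obtain ⟨hm', C', a', hC', ha', hb'⟩ := id hG'
  refine (hasDerivAt_integral_of_dominated_loc_of_deriv_le
    (F := fun x z => G (x + z * s)) (F' := fun x z => G' (x + z * s))
    (bound := fun z => (C' * exp (a' * (|x| + 1))) * exp ((a' * |s|) * |z|))
    (Metric.ball_mem_nhds x one_pos)
    (Eventually.of_forall fun y => (hG.comp_affine y s).1.aestronglyMeasurable)
    (hG.comp_affine x s).integrable (hG'.comp_affine x s).1.aestronglyMeasurable
    (Eventually.of_forall fun z y hy => ?_) ((integrable_exp_abs _).const_mul _)
    (Eventually.of_forall fun z y _ => ?_)).2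
  · rw [Real.norm_eq_abs, mul_assoc, ← exp_add]
    refine (hb' _).trans ?_
    gcongr
    have h1 : |y| ≤ |x| + 1 := by
      rw [Metric.mem_ball, Real.dist_eq] at hy
      have := abs_add_le x (y - x)
      rw [add_sub_cancel] at this
      linarith
    calc a' * |y + z * s| ≤ a' * (|x| + 1 + |z| * |s|) := by
          gcongr; exact (abs_add_le _ _).trans (by rw [abs_mul]; linarith)
      _ = _ := by ring
  · exact (hd (y + z * s)).comp_add_const y (z * s)

lemma gm_id : ∫ z, z ∂gm = 0 := integral_id_gaussianReal

/-- the two Gaussian constants -/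
def B8 : ℝ := ∫ z, exp (8 * |z|) ∂gm
def b1 : ℝ := ∫ z, exp (-|z|) ∂gm

lemma gm_exp_le {a : ℝ} (ha : a ≤ 8) : ∫ z, exp (a * |z|) ∂gm ≤ B8 :=
  integral_mono (integrable_exp_abs a) (integrable_exp_abs 8) fun z => by
    apply exp_le_exp.2; gcongr

lemma one_le_B8 : 1 ≤ B8 := by
  have := gm_exp_le (a := 0) (by norm_num)
  simpa using this

lemma b1_pos : 0 < b1 := by
  have h : Integrable (fun z : ℝ => exp (-|z|)) gm := by
    simpa using integrable_exp_abs (-1)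
  exact integral_exp_pos h

/-- bounding an integral by `C * B8` -/
lemma gm_bound {F : ℝ → ℝ} (C a : ℝ) (hC : 0 ≤ C) (ha : a ≤ 8)
    (h : ∀ z, |F z| ≤ C * exp (a * |z|)) : |∫ z, F z ∂gm| ≤ C * B8 := by
  calc |∫ z, F z ∂gm| ≤ ∫ z, C * exp (a * |z|) ∂gm := by
        have := norm_integral_le_of_norm_le ((integrable_exp_abs a).const_mul C)
          (Eventually.of_forall (p := fun z => ‖F z‖ ≤ C * exp (a * |z|)) fun z => by simpa using h z)
        simpa using this
    _ = C * ∫ z, exp (a * |z|) ∂gm := integral_const_mul _ _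
    _ ≤ _ := by gcongr; exact gm_exp_le ha

lemma gm_sq : ∫ z, z ^ 2 ∂gm = 1 := by
  have h := variance_fun_id_gaussianReal (μ := 0) (v := 1)
  rw [variance_eq_integral (by fun_prop)] at h
  simpa [integral_id_gaussianReal] using h




def lc (x : ℝ) : ℝ := log (cosh x)
def sch (x : ℝ) : ℝ := 1 - tanh x ^ 2

lemma hasDerivAt_lc (x : ℝ) : HasDerivAt lc (tanh x) x := by
  have := (Real.hasDerivAt_cosh x).log (cosh_pos x).ne'
  rw [tanh_eq_sinh_div_cosh]
  exact this

lemma hasDerivAt_tanh' (x : ℝ) : HasDerivAt tanh (sch x) x := by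
  have h := (Real.hasDerivAt_sinh x).div (Real.hasDerivAt_cosh x) (cosh_pos x).ne'
  have e : tanh = fun y => sinh y / cosh y := by
    ext y; exact tanh_eq_sinh_div_cosh y
  have e2 : sch x = (cosh x * cosh x - sinh x * sinh x) / cosh x ^ 2 := by
    have := (cosh_pos x).ne'
    unfold sch; rw [tanh_eq_sinh_div_cosh]; field_simp
  rw [e2, e]
  exact h

lemma sch_pos (x : ℝ) : 0 < sch x := by
  unfold sch; linarith [tanh_sq_lt_one x]

lemma sch_eq_exp (x : ℝ) : sch x = exp (-2 * lc x) := by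
  have h := cosh_pos x
  unfold sch lc
  rw [tanh_eq_sinh_div_cosh, show -2 * log (cosh x) = -(log (cosh x) + log (cosh x)) by ring,
    exp_neg, exp_add, exp_log h]
  have := cosh_sq x
  field_simp
  linarith

structure Good (c : ℝ) (f g k : ℝ → ℝ) : Prop where
  d1 : ∀ x, HasDerivAt f (g x) x
  d2 : ∀ x, HasDerivAt g (k x) x
  up : ∀ x, k x + g x ^ 2 ≤ 1
  c0 : 0 ≤ c
  lo : ∀ x, c * sch x ≤ k x

lemma good_lc : Good 1 lc tanh sch where
  d1 := hasDerivAt_lc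
  d2 := hasDerivAt_tanh'
  up x := by unfold sch; linarith
  c0 := zero_le_one
  lo x := by simp

namespace Good
variable {c : ℝ} {f g k : ℝ → ℝ}

lemma k0 (H : Good c f g k) (x : ℝ) : 0 ≤ k x :=
  (mul_nonneg H.c0 (sch_pos x).le).trans (H.lo x)

lemma k1 (H : Good c f g k) (x : ℝ) : k x ≤ 1 := by nlinarith [H.up x, sq_nonneg (g x)]

lemma g1 (H : Good c f g k) (x : ℝ) : |g x| ≤ 1 := by
  rw [← sq_le_one_iff_abs_le_one]; linarith [H.up x, H.k0 x]

lemma flip (H : Good c f g k) (x y : ℝ) : |f y - f x| ≤ |y - x| := by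
  have := Convex.norm_image_sub_le_of_norm_hasDerivWithin_le (f := f) (f' := g) (s := univ) (C := 1)
    (fun z _ => (H.d1 z).hasDerivWithinAt) (fun z _ => by simpa using H.g1 z) convex_univ
    (mem_univ x) (mem_univ y)
  simpa using this

lemma glip (H : Good c f g k) (x y : ℝ) : |g y - g x| ≤ |y - x| := by
  have := Convex.norm_image_sub_le_of_norm_hasDerivWithin_le (f := g) (f' := k) (s := univ) (C := 1)
    (fun z _ => (H.d2 z).hasDerivWithinAt)
    (fun z _ => by rw [Real.norm_eq_abs, abs_of_nonneg (H.k0 z)]; exact H.k1 z) convex_univ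
    (mem_univ x) (mem_univ y)
  simpa using this

lemma taylor (H : Good c f g k) (y t : ℝ) : |f (y + t) - f y - g y * t| ≤ t ^ 2 := by
  have hd : ∀ z ∈ segment ℝ y (y + t), HasDerivWithinAt (fun z => f z - g y * z) (g z - g y)
      (segment ℝ y (y + t)) z := fun z _ => by
    have h2 : HasDerivAt (fun z : ℝ => g y * z) (g y) z := by
      simpa using (hasDerivAt_id z).const_mul (g y)
    exact ((H.d1 z).sub h2).hasDerivWithinAt
  have := Convex.norm_image_sub_le_of_norm_hasDerivWithin_le (C := |t|) hd
    (fun z hz => by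
      rw [Real.norm_eq_abs]
      refine (H.glip y z).trans ?_
      rw [segment_eq_uIcc] at hz
      have := abs_sub_left_of_mem_uIcc hz
      simpa using this) (convex_segment _ _)
    (left_mem_segment ℝ _ _) (right_mem_segment ℝ _ _)
  rw [Real.norm_eq_abs, Real.norm_eq_abs, add_sub_cancel_left, abs_mul_abs_self] at this
  rw [pow_two]
  convert this using 2
  ring

lemma fmeas (H : Good c f g k) : Measurable f :=
  (continuous_iff_continuousAt.2 fun x => (H.d1 x).continuousAt).measurable
lemma gmeas (H : Good c f g k) : Measurable g :=
  (continuous_iff_continuousAt.2 fun x => (H.d2 x).continuousAt).measurable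
lemma kmeas (H : Good c f g k) : Measurable k := by
  have : k = deriv g := by ext x; exact (H.d2 x).deriv.symm
  rw [this]; exact measurable_deriv g

lemma fEG (H : Good c f g k) : EG f :=
  EG.lip H.fmeas 1 zero_le_one fun z => by simpa using H.flip 0 z
lemma gEG (H : Good c f g k) : EG g := EG.of_bdd H.gmeas 1 H.g1
lemma kEG (H : Good c f g k) : EG k :=
  EG.of_bdd H.kmeas 1 fun x => by rw [abs_of_nonneg (H.k0 x)]; exact H.k1 x
lemma eEG (H : Good c f g k) {m : ℝ} (hm : 0 ≤ m) : EG (fun y => exp (m * f y)) :=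
  EG.exp_lip (H.fmeas.const_mul m) m hm fun z => by
    rw [← mul_sub, abs_mul, abs_of_nonneg hm]
    exact mul_le_mul_of_nonneg_left (by simpa using H.flip 0 z) hm

end Good

def Zf (m s : ℝ) (f : ℝ → ℝ) (x : ℝ) : ℝ := ∫ z, exp (m * f (x + z * s)) ∂gm
def Nf (m s : ℝ) (f G : ℝ → ℝ) (x : ℝ) : ℝ := ∫ z, G (x + z * s) * exp (m * f (x + z * s)) ∂gm
def Tn (m s : ℝ) (f : ℝ → ℝ) (x : ℝ) : ℝ := m⁻¹ * log (Zf m s f x)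
def Tg (m s : ℝ) (f g : ℝ → ℝ) (x : ℝ) : ℝ := Nf m s f g x / Zf m s f x
def Tk (m s : ℝ) (f g k : ℝ → ℝ) (x : ℝ) : ℝ :=
  Nf m s f (fun y => k y + m * g y ^ 2) x / Zf m s f x - m * Tg m s f g x ^ 2

namespace Good
variable {c : ℝ} {f g k : ℝ → ℝ}

lemma Zpos (H : Good c f g k) {m : ℝ} (hm : 0 ≤ m) (s x : ℝ) : 0 < Zf m s f x :=
  integral_exp_pos ((H.eEG hm).comp_affine x s).integrable

lemma N_int (H : Good c f g k) {m : ℝ} (hm : 0 ≤ m) (s x : ℝ) {G : ℝ → ℝ} (hG : EG G) :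
    Integrable (fun z => G (x + z * s) * exp (m * f (x + z * s))) gm :=
  ((hG.mul (H.eEG hm)).comp_affine x s).integrable

lemma dZ (H : Good c f g k) {m : ℝ} (hm : 0 ≤ m) (s x : ℝ) :
    HasDerivAt (Zf m s f) (m * Nf m s f g x) x := by
  have h := hasDerivAt_gm (G := fun y => exp (m * f y)) (G' := fun y => m * (g y * exp (m * f y)))
    (H.eEG hm) ((H.gEG.mul (H.eEG hm)).cmul m) (fun y => by
      exact ((H.d1 y).const_mul m).exp.congr_deriv (by ring)) s x
  rw [integral_const_mul] at h
  exact h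

lemma dN (H : Good c f g k) {m : ℝ} (hm : 0 ≤ m) (s x : ℝ) :
    HasDerivAt (Nf m s f g) (Nf m s f (fun y => k y + m * g y ^ 2) x) x := by
  have h := hasDerivAt_gm (G := fun y => g y * exp (m * f y))
    (G' := fun y => (k y + m * g y ^ 2) * exp (m * f y))
    (H.gEG.mul (H.eEG hm)) ((H.kEG.add (H.gEG.sq.cmul m)).mul (H.eEG hm)) (fun y => by
      exact ((H.d2 y).mul ((H.d1 y).const_mul m).exp).congr_deriv (by ring)) s x
  exact h

lemma dT (H : Good c f g k) {m : ℝ} (hm : 0 < m) (s x : ℝ) :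
    HasDerivAt (Tn m s f) (Tg m s f g x) x := by
  have h := ((H.dZ hm.le s x).log (H.Zpos hm.le s x).ne').const_mul m⁻¹
  refine h.congr_deriv ?_
  have := H.Zpos hm.le s x
  unfold Tg
  field_simp

lemma dTg (H : Good c f g k) {m : ℝ} (hm : 0 < m) (s x : ℝ) :
    HasDerivAt (Tg m s f g) (Tk m s f g k x) x := by
  have h := (H.dN hm.le s x).div (H.dZ hm.le s x) (H.Zpos hm.le s x).ne'
  refine h.congr_deriv ?_
  have := H.Zpos hm.le s x
  unfold Tk Tg
  field_simp

lemma Nadd (H : Good c f g k) {m : ℝ} (hm : 0 ≤ m) (s x a b : ℝ) {F G : ℝ → ℝ} (hF : EG F)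
    (hG : EG G) : Nf m s f (fun y => a * F y + b * G y) x = a * Nf m s f F x + b * Nf m s f G x := by
  unfold Nf
  rw [← integral_const_mul, ← integral_const_mul, ← integral_add
    ((H.N_int hm s x hF).const_mul a) ((H.N_int hm s x hG).const_mul b)]
  congr 1; ext z; ring

lemma Nmono (H : Good c f g k) {m : ℝ} (hm : 0 ≤ m) (s x : ℝ) {F G : ℝ → ℝ} (hF : EG F)
    (hG : EG G) (h : ∀ y, F y ≤ G y) : Nf m s f F x ≤ Nf m s f G x :=
  integral_mono (H.N_int hm s x hF) (H.N_int hm s x hG) fun z =>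
    mul_le_mul_of_nonneg_right (h _) (exp_pos _).le

lemma None (m s x : ℝ) : Nf m s f (fun _ => 1) x = Zf m s f x := by
  unfold Nf Zf; simp

lemma Tg_sq (H : Good c f g k) {m : ℝ} (hm : 0 ≤ m) (s x : ℝ) :
    Tg m s f g x ^ 2 * Zf m s f x ≤ Nf m s f (fun y => g y ^ 2) x := by
  set p := Tg m s f g x with hp
  have hZ := H.Zpos hm s x
  have hN : Nf m s f g x = p * Zf m s f x := by
    rw [hp, Tg]; field_simp
  have h1 : Nf m s f (fun y => 2 * p * g y + (-p ^ 2) * 1) x ≤ Nf m s f (fun y => g y ^ 2) x :=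
    H.Nmono hm s x ((H.gEG.cmul _).add (EG.const _)) H.gEG.sq fun y => by
      nlinarith [sq_nonneg (g y - p)]
  rw [H.Nadd hm s x _ _ H.gEG (EG.const 1), None, hN] at h1
  nlinarith

lemma sch_lower (x t : ℝ) : sch x * (1 - 2 * tanh x * t - 2 * t ^ 2) ≤ sch (x + t) := by
  have h := (abs_le.1 (good_lc.taylor x t)).2
  have h2 := add_one_le_exp (-2 * (lc (x + t) - lc x))
  have : sch (x + t) = sch x * exp (-2 * (lc (x + t) - lc x)) := by
    rw [sch_eq_exp, sch_eq_exp, ← exp_add]; congr 1; ring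
  rw [this]
  apply mul_le_mul_of_nonneg_left _ (sch_pos x).le
  nlinarith

lemma tilt (H : Good c f g k) {m s : ℝ} (hm : 0 < m) (hm1 : m ≤ 1) (hs : 0 ≤ s) (hs1 : s ≤ 1)
    (x z : ℝ) : |m * (f (x + z * s) - f x)| ≤ s * |z| := by
  rw [abs_mul, abs_of_pos hm]
  have := H.flip x (x + z * s)
  rw [add_sub_cancel_left, abs_mul, abs_of_nonneg hs] at this
  nlinarith [abs_nonneg (f (x + z * s) - f x)]

lemma exp_sub_one_le (a : ℝ) : |exp a - 1| ≤ |a| * exp |a| := by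
  have h1 := add_one_le_exp a
  have h2 := add_one_le_exp (-a)
  have h3 : exp a * exp (-a) = 1 := by rw [← exp_add]; simp
  have hp := exp_pos a
  rcases le_or_gt 0 a with h | h
  · rw [abs_of_nonneg h, abs_of_nonneg (by linarith)]; nlinarith
  · rw [abs_of_neg h, abs_of_nonpos (by nlinarith)]
    have : 1 ≤ exp (-a) := one_le_exp (by linarith)
    nlinarith

lemma sch_N (H : Good c f g k) {m s : ℝ} (hm : 0 < m) (hm1 : m ≤ 1) (hs : 0 ≤ s) (hs1 : s ≤ 1)
    (x : ℝ) : sch x * (1 - 8 * B8 / b1 * s ^ 2) * Zf m s f x ≤ Nf m s f sch x := by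
  set w : ℝ → ℝ := fun z => exp (m * (f (x + z * s) - f x)) with hw
  have hwe : ∀ z, exp (m * f (x + z * s)) = exp (m * f x) * w z := fun z => by
    rw [hw, ← exp_add]; congr 1; ring
  have hwEG : EG w := by
    have := ((H.eEG hm.le).comp_affine x s).cmul (exp (-(m * f x)))
    have e : w = fun z => exp (-(m * f x)) * exp (m * f (x + z * s)) := by
      ext z
      rw [hw, ← exp_add]; congr 1; ring
    rw [e]; exact this
  have hwb : ∀ z, w z ≤ exp |z| := fun z => by
    apply exp_le_exp.2
    nlinarith [H.tilt hm hm1 hs hs1 x z, le_abs_self (m * (f (x + z * s) - f x)), abs_nonneg z]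
  have hZ0 : b1 ≤ ∫ z, w z ∂gm := by
    refine integral_mono (by simpa using integrable_exp_abs (-1)) hwEG.integrable fun z => ?_
    apply exp_le_exp.2
    nlinarith [H.tilt hm hm1 hs hs1 x z, neg_abs_le (m * (f (x + z * s) - f x)), abs_nonneg z]
  have hz1 : |∫ z, z * w z ∂gm| ≤ s * (2 * B8) := by
    have : ∫ z, z * w z ∂gm = ∫ z, z * (w z - 1) ∂gm := by
      simp_rw [mul_sub, mul_one]
      rw [integral_sub (EG.id.mul hwEG).integrable EG.id.integrable, gm_id, sub_zero]
    rw [this, ← mul_assoc]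
    refine gm_bound _ 2 (by positivity) (by norm_num) fun z => ?_
    have h1 := exp_sub_one_le (m * (f (x + z * s) - f x))
    have h2 := H.tilt hm hm1 hs hs1 x z
    have h3 : exp |m * (f (x + z * s) - f x)| ≤ exp |z| :=
      exp_le_exp.2 (by nlinarith [abs_nonneg z])
    rw [abs_mul]
    calc |z| * |w z - 1| ≤ |z| * ((s * |z|) * exp |z|) := by
          gcongr; exact h1.trans (by gcongr)
      _ = s * z ^ 2 * exp |z| := by rw [← sq_abs z]; ring
      _ ≤ s * (2 * exp |z|) * exp |z| := by gcongr; exact sq_le_exp_abs z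
      _ = s * 2 * exp (2 * |z|) := by rw [two_mul |z|, exp_add]; ring
  have hz2 : ∫ z, z ^ 2 * w z ∂gm ≤ 2 * B8 := by
    refine (le_abs_self _).trans (gm_bound _ 2 (by positivity) (by norm_num) fun z => ?_)
    rw [abs_of_nonneg (by positivity)]
    calc z ^ 2 * w z ≤ (2 * exp |z|) * exp |z| := by
          gcongr; exacts [sq_le_exp_abs z, hwb z]
      _ = 2 * exp (2 * |z|) := by rw [two_mul |z|, exp_add]; ring
  have hZe : Zf m s f x = exp (m * f x) * ∫ z, w z ∂gm := by
    unfold Zf; simp_rw [hwe]; rw [integral_const_mul]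
  have hNe : Nf m s f sch x = exp (m * f x) * ∫ z, sch (x + z * s) * w z ∂gm := by
    unfold Nf; simp_rw [hwe, mul_left_comm _ (exp (m * f x))]; rw [integral_const_mul]
  have hlow : sch x * ((∫ z, w z ∂gm) - 2 * tanh x * s * (∫ z, z * w z ∂gm)
      - 2 * s ^ 2 * ∫ z, z ^ 2 * w z ∂gm) ≤ ∫ z, sch (x + z * s) * w z ∂gm := by
    have i0 := hwEG
    have i1 := (EG.id.mul hwEG).cmul (2 * tanh x * s)
    have i2 := (EG.id.sq.mul hwEG).cmul (2 * s ^ 2)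
    rw [← integral_const_mul, ← integral_const_mul, ← integral_sub i0.integrable i1.integrable,
      ← integral_sub (i0.sub i1).integrable i2.integrable, ← integral_const_mul]
    refine integral_mono (((i0.sub i1).sub i2).cmul _).integrable
      ((good_lc.kEG.comp_affine x s).mul hwEG).integrable fun z => ?_
    have := mul_le_mul_of_nonneg_right (sch_lower x (z * s)) (exp_pos (m * (f (x + z * s) - f x))).le
    simp only [hw] at this ⊢
    refine le_trans (le_of_eq ?_) this
    ring
  have hb := b1_pos
  have hB := one_le_B8
  have ht := abs_le.1 (abs_tanh_lt_one x).le
  have hfin : (1 - 8 * B8 / b1 * s ^ 2) * (∫ z, w z ∂gm) ≤ (∫ z, w z ∂gm) -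
      2 * tanh x * s * (∫ z, z * w z ∂gm) - 2 * s ^ 2 * ∫ z, z ^ 2 * w z ∂gm := by
    have e1 : 8 * B8 * s ^ 2 ≤ 8 * B8 / b1 * s ^ 2 * ∫ z, w z ∂gm := by
      calc 8 * B8 * s ^ 2 = 8 * B8 / b1 * s ^ 2 * b1 := by field_simp
        _ ≤ _ := by gcongr
    have e2 : tanh x * (∫ z, z * w z ∂gm) ≤ s * (2 * B8) := by
      refine (le_abs_self _).trans ?_
      rw [abs_mul]
      have := (abs_tanh_lt_one x).le
      nlinarith [abs_nonneg (∫ z, z * w z ∂gm)]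
    have e3 : s * (tanh x * (∫ z, z * w z ∂gm)) ≤ s * (s * (2 * B8)) := by gcongr
    have e4 : s ^ 2 * (∫ z, z ^ 2 * w z ∂gm) ≤ s ^ 2 * (2 * B8) := by gcongr
    nlinarith
  rw [hZe, hNe]
  calc _ = exp (m * f x) * (sch x * ((1 - 8 * B8 / b1 * s ^ 2) * (∫ z, w z ∂gm))) := by ring
    _ ≤ exp (m * f x) * (∫ z, sch (x + z * s) * w z ∂gm) := by
      gcongr
      exact (mul_le_mul_of_nonneg_left hfin (sch_pos x).le).trans hlow

theorem step (H : Good c f g k) {m s : ℝ} (hm : 0 < m) (hm1 : m ≤ 1) (hs : 0 ≤ s) (hs1 : s ≤ 1)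
    (hC : 8 * B8 / b1 * s ^ 2 ≤ 1) :
    Good (c * (1 - 8 * B8 / b1 * s ^ 2)) (Tn m s f) (Tg m s f g) (Tk m s f g k) where
  d1 := H.dT hm s
  d2 := H.dTg hm s
  c0 := mul_nonneg H.c0 (by linarith)
  up x := by
    have hZ := H.Zpos hm.le s x
    have h1 := H.Tg_sq hm.le s x
    have h2 : Nf m s f (fun y => k y + m * g y ^ 2) x ≤
        Nf m s f (fun y => 1 * 1 + (-(1 - m)) * g y ^ 2) x :=
      H.Nmono hm.le s x (H.kEG.add (H.gEG.sq.cmul m)) ((EG.const _).add (H.gEG.sq.cmul _))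
        fun y => by nlinarith [H.up y]
    rw [H.Nadd hm.le s x _ _ (EG.const 1) H.gEG.sq, None] at h2
    have h3 : Nf m s f (fun y => k y + m * g y ^ 2) x / Zf m s f x ≤
        1 - (1 - m) * Tg m s f g x ^ 2 := by
      rw [div_le_iff₀ hZ]; nlinarith
    unfold Tk
    linarith
  lo x := by
    have hZ := H.Zpos hm.le s x
    have h1 := H.Tg_sq hm.le s x
    have h2 : Nf m s f (fun y => c * sch y + m * g y ^ 2) x ≤
        Nf m s f (fun y => k y + m * g y ^ 2) x :=
      H.Nmono hm.le s x ((good_lc.kEG.cmul c).add (H.gEG.sq.cmul m)) (H.kEG.add (H.gEG.sq.cmul m))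
        fun y => by linarith [H.lo y]
    rw [H.Nadd hm.le s x _ _ good_lc.kEG H.gEG.sq] at h2
    have h3 := mul_le_mul_of_nonneg_left (H.sch_N hm hm1 hs hs1 x) H.c0
    unfold Tk
    rw [le_sub_iff_add_le, le_div_iff₀ hZ]
    nlinarith

end Good



/-- shifted exponent -/
def hh (m s u : ℝ) (f : ℝ → ℝ) (y w : ℝ) : ℝ := m * (f (y + w * s) - f y - s * u * w)

def C1 : ℝ := B8 / b1
def C2 : ℝ := 2 + C1
def C3 : ℝ := C2 ^ 2 * B8 + 2 * C2 * B8 ^ 2 / b1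

lemma C1_nonneg : 0 ≤ C1 := div_nonneg (by linarith [one_le_B8]) b1_pos.le
lemma C2_pos : 0 < C2 := by unfold C2; linarith [C1_nonneg]
lemma C3_pos : 0 < C3 := by
  have := C2_pos; have := one_le_B8; have := b1_pos
  unfold C3; positivity

namespace Good
variable {c : ℝ} {f g k : ℝ → ℝ}

lemma N_shift (m s u : ℝ) (f G : ℝ → ℝ) (x : ℝ) :
    Nf m s f G x = exp (m * f (x + m * s ^ 2 * u) - m ^ 2 * s ^ 2 * u ^ 2 / 2) *
      ∫ w, G (x + m * s ^ 2 * u + w * s) * exp (hh m s u f (x + m * s ^ 2 * u) w) ∂gm := by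
  unfold Nf
  rw [gm_shift _ (m * s * u), ← integral_const_mul]
  congr 1
  ext w
  rw [show x + (w + m * s * u) * s = x + m * s ^ 2 * u + w * s by ring, mul_assoc, ← exp_add,
    mul_left_comm, ← exp_add]
  congr 2
  unfold hh
  ring

lemma Z_shift (m s u : ℝ) (f : ℝ → ℝ) (x : ℝ) :
    Zf m s f x = exp (m * f (x + m * s ^ 2 * u) - m ^ 2 * s ^ 2 * u ^ 2 / 2) *
      ∫ w, exp (hh m s u f (x + m * s ^ 2 * u) w) ∂gm := by
  rw [← None, N_shift m s u]
  simp

lemma hh_EG (H : Good c f g k) (m s u y : ℝ) : EG (hh m s u f y) := by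
  have := (((H.fEG.comp_affine y s).sub (EG.const (f y))).sub (EG.id.cmul (s * u))).cmul m
  exact this

lemma exp_hh_EG (H : Good c f g k) {m : ℝ} (hm : 0 ≤ m) (s u y : ℝ) :
    EG (fun w => exp (hh m s u f y w)) := by
  refine EG.exp_lip (H.hh_EG m s u y).1 (m * (|s| + |s * u|)) (by positivity) fun z => ?_
  have h := H.flip y (y + z * s)
  have e : hh m s u f y z - hh m s u f y 0 = m * ((f (y + z * s) - f y) - s * u * z) := by
    simp [hh]
  rw [e, abs_mul, abs_of_nonneg hm, mul_assoc m]
  apply mul_le_mul_of_nonneg_left _ hm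
  rw [add_sub_cancel_left, abs_mul] at h
  have := abs_sub (f (y + z * s) - f y) (s * u * z)
  rw [abs_mul (s * u) z] at this
  linarith

lemma T_shift (H : Good c f g k) {m : ℝ} (hm : 0 < m) (s u x : ℝ) :
    Tn m s f x = f (x + m * s ^ 2 * u) - m / 2 * s ^ 2 * u ^ 2 +
      m⁻¹ * log (∫ w, exp (hh m s u f (x + m * s ^ 2 * u) w) ∂gm) := by
  unfold Tn
  rw [Z_shift m s u, log_mul (exp_pos _).ne'
    (integral_exp_pos (H.exp_hh_EG hm.le s u _).integrable).ne', log_exp]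
  field_simp

lemma int_hh (H : Good c f g k) (m s u y : ℝ) :
    ∫ w, hh m s u f y w ∂gm = m * ((∫ w, f (y + w * s) ∂gm) - f y) := by
  unfold hh
  rw [integral_const_mul, integral_sub, integral_sub, integral_const_mul, gm_id]
  · simp
  · exact (H.fEG.comp_affine y s).integrable
  · exact integrable_const _
  · exact ((H.fEG.comp_affine y s).sub (EG.const _)).integrable
  · exact (EG.id.cmul (s * u)).integrable

/-- variational lower bound -/
lemma T_ge (H : Good c f g k) {m : ℝ} (hm : 0 < m) (s u x : ℝ) :
    (∫ w, f (x + m * s ^ 2 * u + w * s) ∂gm) - m / 2 * s ^ 2 * u ^ 2 ≤ Tn m s f x := by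
  rw [H.T_shift hm s u x]
  set y := x + m * s ^ 2 * u
  have hpos := integral_exp_pos (H.exp_hh_EG hm.le s u y).integrable
  set I := ∫ w, hh m s u f y w ∂gm with hI
  have hJ : exp I ≤ ∫ w, exp (hh m s u f y w) ∂gm := by
    have h1 : ∫ w, exp I * (hh m s u f y w + (1 - I)) ∂gm = exp I := by
      rw [integral_const_mul, integral_add (H.hh_EG m s u y).integrable (integrable_const _), ← hI]
      simp
    rw [← h1]
    refine integral_mono (((H.hh_EG m s u y).add (EG.const _)).cmul _).integrable
      (H.exp_hh_EG hm.le s u y).integrable fun w => ?_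
    have := add_one_le_exp (hh m s u f y w - I)
    calc exp I * (hh m s u f y w + (1 - I)) ≤ exp I * exp (hh m s u f y w - I) := by
          gcongr; linarith
      _ = _ := by rw [← exp_add]; congr 1; ring
  have h2 := (le_log_iff_exp_le hpos).2 hJ
  rw [H.int_hh] at hI
  have h3 : m⁻¹ * I = (∫ w, f (y + w * s) ∂gm) - f y := by
    rw [hI, inv_mul_cancel_left₀ hm.ne']
  have h4 : m⁻¹ * I ≤ m⁻¹ * log (∫ w, exp (hh m s u f y w) ∂gm) := by gcongr
  linarith

lemma Tg_le (H : Good c f g k) {m : ℝ} (hm : 0 < m) (s x : ℝ) : |Tg m s f g x| ≤ 1 := by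
  have hZ := H.Zpos hm.le s x
  unfold Tg
  rw [abs_div, abs_of_pos hZ, div_le_one hZ]
  unfold Nf Zf
  refine (abs_integral_le_integral_abs).trans (integral_mono
    (H.N_int hm.le s x H.gEG).abs ((H.eEG hm.le).comp_affine x s).integrable fun z => ?_)
  simp only [abs_mul, abs_of_pos (exp_pos _)]
  nlinarith [H.g1 (x + z * s), exp_pos (m * f (x + z * s))]

section

lemma hh_le (H : Good c f g k) {m s : ℝ} (hm : 0 < m) (hm1 : m ≤ 1) (hs : 0 ≤ s)
    (hs1 : s ≤ 1 / 2) {u : ℝ} (hu : |u| ≤ 1) (y w : ℝ) : |hh m s u f y w| ≤ |w| := by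
  have h := H.flip y (y + w * s)
  rw [add_sub_cancel_left, abs_mul, abs_of_nonneg hs] at h
  unfold hh
  rw [abs_mul, abs_of_pos hm]
  have h2 := abs_sub (f (y + w * s) - f y) (s * u * w)
  rw [abs_mul (s * u) w, abs_mul, abs_of_nonneg hs] at h2
  have h3 : s * |u| * |w| ≤ s * 1 * |w| := by gcongr
  have h4 : |f (y + w * s) - f y - s * u * w| ≤ |w| := by nlinarith [abs_nonneg w]
  calc _ ≤ 1 * |f (y + w * s) - f y - s * u * w| := by gcongr
    _ ≤ _ := by simpa using h4

lemma H_ge (H : Good c f g k) {m s : ℝ} (hm : 0 < m) (hm1 : m ≤ 1) (hs : 0 ≤ s)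
    (hs1 : s ≤ 1 / 2) {u : ℝ} (hu : |u| ≤ 1) (y : ℝ) : b1 ≤ ∫ w, exp (hh m s u f y w) ∂gm := by
  refine integral_mono (by simpa using integrable_exp_abs (-1))
    (H.exp_hh_EG hm.le s u y).integrable fun z => ?_
  apply exp_le_exp.2
  linarith [H.hh_le hm hm1 hs hs1 hu y z, neg_abs_le (hh m s u f y z)]

lemma Tg_eq (H : Good c f g k) {m : ℝ} (hm : 0 < m) (s u x : ℝ) :
    Tg m s f g x * (∫ w, exp (hh m s u f (x + m * s ^ 2 * u) w) ∂gm) =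
    ∫ w, g (x + m * s ^ 2 * u + w * s) * exp (hh m s u f (x + m * s ^ 2 * u) w) ∂gm := by
  have hpos := integral_exp_pos (H.exp_hh_EG hm.le s u (x + m * s ^ 2 * u)).integrable
  unfold Tg
  rw [N_shift m s u, Z_shift m s u]
  field_simp

lemma p_close (H : Good c f g k) {m s : ℝ} (hm : 0 < m) (hm1 : m ≤ 1) (hs : 0 ≤ s)
    (hs1 : s ≤ 1 / 2) {u : ℝ} (hu : |u| ≤ 1) (x : ℝ) :
    |Tg m s f g x - g (x + m * s ^ 2 * u)| ≤ s * C1 := by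
  have hH := H.H_ge hm hm1 hs hs1 hu (x + m * s ^ 2 * u)
  have e := H.Tg_eq hm s u x
  set y := x + m * s ^ 2 * u
  set Hh := ∫ w, exp (hh m s u f y w) ∂gm with hHh
  have hb := b1_pos
  have e2 : (Tg m s f g x - g y) * Hh = ∫ w, (g (y + w * s) - g y) * exp (hh m s u f y w) ∂gm := by
    simp_rw [sub_mul]
    rw [integral_sub, integral_const_mul, e]
    · exact ((H.gEG.comp_affine y s).mul (H.exp_hh_EG hm.le s u y)).integrable
    · exact ((H.exp_hh_EG hm.le s u y).cmul _).integrable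
  have h3 : |(Tg m s f g x - g y) * Hh| ≤ s * B8 := by
    rw [e2]
    refine gm_bound _ 2 hs (by norm_num) fun w => ?_
    rw [abs_mul, abs_of_pos (exp_pos _)]
    have h := H.glip y (y + w * s)
    rw [add_sub_cancel_left, abs_mul, abs_of_nonneg hs] at h
    calc _ ≤ (|w| * s) * exp |w| := by
          gcongr
          exact (le_abs_self _).trans (H.hh_le hm hm1 hs hs1 hu y w)
      _ ≤ (exp |w| * s) * exp |w| := by gcongr; exact abs_le_exp_abs w
      _ = s * exp (2 * |w|) := by rw [two_mul |w|, exp_add]; ring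
  rw [abs_mul, abs_of_pos (hb.trans_le hH)] at h3
  unfold C1
  rw [mul_div_assoc', le_div_iff₀ hb]
  refine le_trans ?_ h3
  gcongr

lemma hh_small (H : Good c f g k) {m s : ℝ} (hm : 0 < m) (hm1 : m ≤ 1) (hs : 0 ≤ s)
    (hs1 : s ≤ 1 / 2) (x w : ℝ) :
    |hh m s (Tg m s f g x) f (x + m * s ^ 2 * Tg m s f g x) w| ≤ m * s ^ 2 * C2 * exp |w| := by
  have hp := H.p_close hm hm1 hs hs1 (H.Tg_le hm s x) x
  set p := Tg m s f g x
  set y := x + m * s ^ 2 * p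
  have ht := H.taylor y (w * s)
  unfold hh
  rw [abs_mul, abs_of_pos hm, mul_assoc m, mul_assoc m]
  apply mul_le_mul_of_nonneg_left _ hm.le
  have e : f (y + w * s) - f y - s * p * w = (f (y + w * s) - f y - g y * (w * s)) +
      -(s * w * (p - g y)) := by ring
  rw [e]
  refine (abs_add_le _ _).trans ?_
  rw [abs_neg, abs_mul, abs_mul, abs_of_nonneg hs]
  have h1 := sq_le_exp_abs w
  have h2 := abs_le_exp_abs w
  have h3 : s * |w| * |p - g y| ≤ s * exp |w| * (s * C1) := by gcongr
  have h4 : s ^ 2 * w ^ 2 ≤ s ^ 2 * (2 * exp |w|) := by gcongr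
  unfold C2
  nlinarith

lemma exp_hh_small (H : Good c f g k) {m s : ℝ} (hm : 0 < m) (hm1 : m ≤ 1) (hs : 0 ≤ s)
    (hs1 : s ≤ 1 / 2) (x w : ℝ) :
    |exp (hh m s (Tg m s f g x) f (x + m * s ^ 2 * Tg m s f g x) w) - 1| ≤
      m * s ^ 2 * C2 * exp (2 * |w|) := by
  have h1 := H.hh_small hm hm1 hs hs1 x w
  have h2 := H.hh_le hm hm1 hs hs1 (H.Tg_le hm s x) (x + m * s ^ 2 * Tg m s f g x) w
  refine (exp_sub_one_le _).trans ?_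
  have := C2_pos
  calc _ ≤ (m * s ^ 2 * C2 * exp |w|) * exp |w| := by gcongr
    _ = _ := by rw [two_mul |w|, exp_add]; ring

/-- near optimality of the shift -/
lemma T_le (H : Good c f g k) {m s : ℝ} (hm : 0 < m) (hm1 : m ≤ 1) (hs : 0 ≤ s)
    (hs1 : s ≤ 1 / 2) (x : ℝ) :
    Tn m s f x ≤ (∫ w, f (x + m * s ^ 2 * Tg m s f g x + w * s) ∂gm)
      - m / 2 * s ^ 2 * Tg m s f g x ^ 2 + C3 * s ^ 3 := by
  have hsm := H.hh_small hm hm1 hs hs1 x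
  have hes := H.exp_hh_small hm hm1 hs hs1 x
  rw [H.T_shift hm s (Tg m s f g x) x]
  have hH := H.H_ge hm hm1 hs hs1 (H.Tg_le hm s x) (x + m * s ^ 2 * Tg m s f g x)
  have hI := H.int_hh m s (Tg m s f g x) (x + m * s ^ 2 * Tg m s f g x)
  set p := Tg m s f g x
  set y := x + m * s ^ 2 * p
  have hC2 := C2_pos
  have hB := one_le_B8
  have hb := b1_pos
  have hE := H.exp_hh_EG hm.le s p y
  have hE2 := H.hh_EG m s p y
  have key : (∫ w, exp (hh m s p f y w) ∂gm) - 1 - (∫ w, hh m s p f y w ∂gm) ≤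
      m ^ 2 * s ^ 4 * C2 ^ 2 * B8 := by
    have e : (∫ w, exp (hh m s p f y w) ∂gm) - 1 - (∫ w, hh m s p f y w ∂gm) =
        ∫ w, (exp (hh m s p f y w) - 1 - hh m s p f y w) ∂gm := by
      rw [integral_sub (hE.sub (EG.const 1)).integrable hE2.integrable,
        integral_sub hE.integrable (integrable_const _)]
      simp
    rw [e]
    refine (le_abs_self _).trans (gm_bound _ 3 (by positivity) (by norm_num) fun w => ?_)
    set a := hh m s p f y w
    have h0 := add_one_le_exp a
    rw [abs_of_nonneg (by linarith)]
    have h1 : exp a - 1 - a ≤ a * (exp a - 1) := by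
      have := add_one_le_exp (-a)
      have h3 : exp a * exp (-a) = 1 := by rw [← exp_add]; simp
      nlinarith [exp_pos a]
    calc _ ≤ a * (exp a - 1) := h1
      _ ≤ |a| * |exp a - 1| := by rw [← abs_mul]; exact le_abs_self _
      _ ≤ (m * s ^ 2 * C2 * exp |w|) * (m * s ^ 2 * C2 * exp (2 * |w|)) := by
        gcongr
        exacts [hsm w, hes w]
      _ = m ^ 2 * s ^ 4 * C2 ^ 2 * exp (3 * |w|) := by
        rw [show 3 * |w| = |w| + 2 * |w| by ring, exp_add]; ring
  have hlog := log_le_sub_one_of_pos (hb.trans_le hH)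
  have h1 : m⁻¹ * log (∫ w, exp (hh m s p f y w) ∂gm) ≤
      m⁻¹ * (m * ((∫ w, f (y + w * s) ∂gm) - f y) + m ^ 2 * s ^ 4 * C2 ^ 2 * B8) := by
    gcongr
    linarith
  have h2 : m⁻¹ * (m * ((∫ w, f (y + w * s) ∂gm) - f y) + m ^ 2 * s ^ 4 * C2 ^ 2 * B8) =
      (∫ w, f (y + w * s) ∂gm) - f y + m * s ^ 4 * (C2 ^ 2 * B8) := by
    generalize (∫ w, f (y + w * s) ∂gm) = I
    field_simp
  have h3 : m * s ^ 4 * (C2 ^ 2 * B8) ≤ C3 * s ^ 3 := by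
    have hx : m * s ^ 4 ≤ s ^ 3 := by
      have : 0 ≤ s ^ 3 := by positivity
      have : m * s ≤ 1 := by nlinarith
      calc m * s ^ 4 = (m * s) * s ^ 3 := by ring
        _ ≤ 1 * s ^ 3 := by gcongr
        _ = _ := one_mul _
    have hy : C2 ^ 2 * B8 ≤ C3 := by
      unfold C3
      have : 0 ≤ 2 * C2 * B8 ^ 2 / b1 := by positivity
      linarith
    have : 0 ≤ C3 := C3_pos.le
    calc _ ≤ s ^ 3 * C3 := by gcongr
      _ = _ := mul_comm _ _
  linarith

/-- approximate martingale property -/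
lemma mart (H : Good c f g k) {m s : ℝ} (hm : 0 < m) (hm1 : m ≤ 1) (hs : 0 ≤ s)
    (hs1 : s ≤ 1 / 2) (x : ℝ) :
    |(∫ w, g (x + m * s ^ 2 * Tg m s f g x + w * s) ∂gm) - Tg m s f g x| ≤ C3 * s ^ 3 := by
  have hes := H.exp_hh_small hm hm1 hs hs1 x
  have hH := H.H_ge hm hm1 hs hs1 (H.Tg_le hm s x) (x + m * s ^ 2 * Tg m s f g x)
  have e := H.Tg_eq hm s (Tg m s f g x) x
  set p := Tg m s f g x
  set y := x + m * s ^ 2 * p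
  set Hh := ∫ w, exp (hh m s p f y w) ∂gm with hHh
  have hC2 := C2_pos
  have hB := one_le_B8
  have hb := b1_pos
  have hE := H.exp_hh_EG hm.le s p y
  have hg := H.gEG.comp_affine y s
  have hH1 : |Hh - 1| ≤ m * s ^ 2 * C2 * B8 := by
    have : Hh - 1 = ∫ w, (exp (hh m s p f y w) - 1) ∂gm := by
      rw [integral_sub hE.integrable (integrable_const _)]; simp [hHh]
    rw [this]
    exact gm_bound _ 2 (by positivity) (by norm_num) hes
  have e2 : ((∫ w, g (y + w * s) ∂gm) - p) * Hh =
      ∫ w, (g (y + w * s) - g y) * (Hh - exp (hh m s p f y w)) ∂gm := by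
    have : ∀ w, (g (y + w * s) - g y) * (Hh - exp (hh m s p f y w)) =
      (Hh * g (y + w * s) - g (y + w * s) * exp (hh m s p f y w))
        - (g y * Hh - g y * exp (hh m s p f y w)) := fun w => by ring
    simp_rw [this]
    rw [integral_sub ((hg.cmul Hh).sub (hg.mul hE)).integrable
        ((EG.const _).sub (hE.cmul _)).integrable,
      integral_sub (hg.cmul Hh).integrable (hg.mul hE).integrable,
      integral_sub (integrable_const _) (hE.cmul _).integrable, integral_const_mul,
      integral_const_mul (g y) (fun w => exp (hh m s p f y w)), ← e, ← hHh, integral_const]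
    simp
    ring
  have h3 : |((∫ w, g (y + w * s) ∂gm) - p) * Hh| ≤ s ^ 3 * (2 * C2 * B8) * B8 := by
    rw [e2]
    refine gm_bound _ 3 (by positivity) (by norm_num) fun w => ?_
    rw [abs_mul]
    have h := H.glip y (y + w * s)
    rw [add_sub_cancel_left, abs_mul, abs_of_nonneg hs] at h
    have h5 : |Hh - exp (hh m s p f y w)| ≤ s ^ 2 * (2 * C2 * B8) * exp (2 * |w|) := by
      have e3 : Hh - exp (hh m s p f y w) = (Hh - 1) - (exp (hh m s p f y w) - 1) := by ring
      rw [e3]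
      refine (abs_sub _ _).trans ?_
      have hexp : 1 ≤ exp (2 * |w|) := one_le_exp (by positivity)
      have a1 : m * s ^ 2 * C2 * B8 ≤ 1 * s ^ 2 * C2 * B8 * exp (2 * |w|) := by
        have : m * s ^ 2 * C2 * B8 * 1 ≤ 1 * s ^ 2 * C2 * B8 * exp (2 * |w|) := by gcongr
        linarith
      have a2 : m * s ^ 2 * C2 * exp (2 * |w|) ≤ 1 * s ^ 2 * C2 * exp (2 * |w|) * B8 := by
        have : m * s ^ 2 * C2 * exp (2 * |w|) * 1 ≤ 1 * s ^ 2 * C2 * exp (2 * |w|) * B8 := by gcongr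
        linarith
      linarith [hes w]
    calc _ ≤ (exp |w| * s) * (s ^ 2 * (2 * C2 * B8) * exp (2 * |w|)) := by
          gcongr
          exact h.trans (by gcongr; exact abs_le_exp_abs w)
      _ = s ^ 3 * (2 * C2 * B8) * exp (3 * |w|) := by
        rw [show 3 * |w| = |w| + 2 * |w| by ring, exp_add]; ring
  rw [abs_mul, abs_of_pos (hb.trans_le hH)] at h3
  have h6 : |(∫ w, g (y + w * s) ∂gm) - p| ≤ 2 * C2 * B8 ^ 2 / b1 * s ^ 3 := by
    rw [div_mul_eq_mul_div, le_div_iff₀ hb]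
    calc _ ≤ |(∫ w, g (y + w * s) ∂gm) - p| * Hh := by gcongr
      _ ≤ _ := h3
      _ = _ := by ring
  refine h6.trans ?_
  unfold C3
  gcongr
  have : 0 ≤ C2 ^ 2 * B8 := by positivity
  linarith

end

def qq : ℝ := min (gm.real (Icc 1 2)) (gm.real (Icc (-2) (-1)))

lemma gm_Icc_pos {a b : ℝ} (h : a < b) : 0 < gm.real (Icc a b) := by
  rw [measureReal_def, ENNReal.toReal_pos_iff]
  refine ⟨pos_iff_ne_zero.2 fun h0 => ?_, measure_lt_top _ _⟩
  have := gaussianReal_absolutelyContinuous' 0 (v := 1) (by norm_num) h0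
  simp at this
  linarith

lemma qq_pos : 0 < qq := lt_min (gm_Icc_pos (by norm_num)) (gm_Icc_pos (by norm_num))

lemma sch_anti {x K : ℝ} (h : |x| ≤ K) : sch K ≤ sch x := by
  rw [sch_eq_exp, sch_eq_exp]
  apply exp_le_exp.2
  have : lc x ≤ lc K := by
    unfold lc
    apply log_le_log (cosh_pos x)
    rw [cosh_le_cosh]
    exact h.trans (le_abs_self K)
  linarith

/-- variance lower bound -/
lemma var_ge (H : Good c f g k) {s : ℝ} (hs : 0 ≤ s) (hs1 : s ≤ 1 / 2) (y p K : ℝ)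
    (hy : |y| ≤ K) :
    (c * sch (K + 1)) ^ 2 * qq * s ^ 2 ≤ ∫ w, (g (y + w * s) - p) ^ 2 ∂gm := by
  set b := c * sch (K + 1) with hb
  have hb0 : 0 ≤ b := mul_nonneg H.c0 (sch_pos _).le
  have hk : ∀ t, |t - y| ≤ 1 → b ≤ k t := fun t ht => by
    refine le_trans ?_ (H.lo t)
    apply mul_le_mul_of_nonneg_left _ H.c0
    apply sch_anti
    have := abs_add_le y (t - y)
    rw [add_sub_cancel] at this
    linarith
  have mvt : ∀ t, 0 ≤ t → t ≤ 1 → b * t ≤ g (y + t) - g y ∧ b * t ≤ g y - g (y - t) := by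
    intro t ht ht1
    have hmono : MonotoneOn (fun z => g z - b * z) (Icc (y - 1) (y + 1)) := by
      refine monotoneOn_of_hasDerivWithinAt_nonneg (f' := fun z => k z - b) (convex_Icc _ _) ?_ ?_ ?_
      · exact fun z _ => ((H.d2 z).continuousAt.sub (by fun_prop)).continuousWithinAt
      · intro z _
        have h2 : HasDerivAt (fun z : ℝ => b * z) b z := by
          simpa using (hasDerivAt_id z).const_mul b
        exact ((H.d2 z).sub h2).hasDerivWithinAt
      · intro z hz
        rw [interior_Icc] at hz
        have := hk z (abs_le.2 ⟨by linarith [hz.1], by linarith [hz.2]⟩)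
        linarith
    have hyI : y ∈ Icc (y - 1) (y + 1) := ⟨by linarith, by linarith⟩
    have h1 := hmono hyI (b := y + t) ⟨by linarith, by linarith⟩ (by linarith)
    have h2 := hmono (a := y - t) ⟨by linarith, by linarith⟩ hyI (by linarith)
    simp only at h1 h2
    constructor <;> linarith
  have hIntg : Integrable (fun w => (g (y + w * s) - p) ^ 2) gm :=
    ((H.gEG.comp_affine y s).sub (EG.const p)).sq.integrable
  have main : ∀ S : Set ℝ, MeasurableSet S → qq ≤ gm.real S →
      (∀ w ∈ S, b ^ 2 * s ^ 2 ≤ (g (y + w * s) - p) ^ 2) →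
      b ^ 2 * qq * s ^ 2 ≤ ∫ w, (g (y + w * s) - p) ^ 2 ∂gm := by
    intro S hS hq hw
    calc b ^ 2 * qq * s ^ 2 ≤ b ^ 2 * gm.real S * s ^ 2 := by gcongr
      _ = ∫ w in S, b ^ 2 * s ^ 2 ∂gm := by rw [setIntegral_const, smul_eq_mul]; ring
      _ ≤ ∫ w in S, (g (y + w * s) - p) ^ 2 ∂gm :=
        setIntegral_mono_on (integrable_const _).integrableOn hIntg.integrableOn hS hw
      _ ≤ _ := setIntegral_le_integral hIntg (Eventually.of_forall fun w => sq_nonneg _)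
  rcases le_total p (g y) with hp | hp
  · refine main (Icc 1 2) measurableSet_Icc (min_le_left _ _) fun w hw => ?_
    have h1 := (mvt (w * s) (by nlinarith [hw.1]) (by nlinarith [hw.2])).1
    rw [← mul_pow]
    apply pow_le_pow_left₀ (by positivity)
    have : b * s ≤ b * (w * s) := by gcongr; nlinarith [hw.1]
    linarith
  · refine main (Icc (-2) (-1)) measurableSet_Icc (min_le_right _ _) fun w hw => ?_
    have h1 := (mvt (-w * s) (by nlinarith [hw.2]) (by nlinarith [hw.1])).2
    rw [show y - -w * s = y + w * s by ring] at h1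
    rw [← mul_pow, ← neg_sq (g _ - p)]
    apply pow_le_pow_left₀ (by positivity)
    have : b * s ≤ b * (-w * s) := by gcongr; nlinarith [hw.2]
    linarith

end Good



lemma lc_strong {l : ℝ} (hl0 : 0 < l) (hl1 : l < 1) {R b : ℝ} (hb : ∀ z ∈ Icc (-R) R, b ≤ sch z)
    {x d : ℝ} (h1 : x - l * d ∈ Icc (-R) R) (h2 : x + (1 - l) * d ∈ Icc (-R) R) :
    b / 2 * (l * (1 - l)) * d ^ 2 ≤
      (1 - l) * lc (x - l * d) + l * lc (x + (1 - l) * d) - lc x := by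
  have hd : ∀ z, HasDerivAt (fun z => lc z - b / 2 * z ^ 2) (tanh z - b * z) z := fun z => by
    refine ((hasDerivAt_lc z).sub ((hasDerivAt_pow 2 z).const_mul (b / 2))).congr_deriv ?_
    push_cast; ring
  have hd2 : ∀ z, HasDerivAt (fun z => tanh z - b * z) (sch z - b) z := fun z => by
    refine ((hasDerivAt_tanh' z).sub ((hasDerivAt_id z).const_mul b)).congr_deriv ?_
    ring
  have hc : ConvexOn ℝ (Icc (-R) R) (fun z => lc z - b / 2 * z ^ 2) := by
    refine convexOn_of_hasDerivWithinAt2_nonneg (f' := fun z => tanh z - b * z)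
      (f'' := fun z => sch z - b) (convex_Icc _ _)
      (fun z _ => (hd z).continuousAt.continuousWithinAt) (fun z _ => (hd z).hasDerivWithinAt)
      (fun z _ => (hd2 z).hasDerivWithinAt) (fun z hz => ?_)
    have := hb z (interior_subset hz)
    linarith
  have := hc.2 h1 h2 (sub_nonneg.2 hl1.le) hl0.le (by ring)
  simp only [smul_eq_mul] at this
  rw [show (1 - l) * (x - l * d) + l * (x + (1 - l) * d) = x by ring] at this
  nlinarith

lemma lc_terminal {l : ℝ} (hl0 : 0 < l) (hl1 : l < 1) {K M : ℝ} (hK : 0 < K) (hM : 0 ≤ M)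
    {x d : ℝ} (hd : |d| ≤ M) :
    sch (K + M) / 2 * (l * (1 - l)) * (d ^ 2 - M ^ 2 / K ^ 2 * (x ^ 2 + 3)) ≤
      (1 - l) * lc (x - l * d) + l * lc (x + (1 - l) * d) - lc x := by
  have hs := sch_pos (K + M)
  have hll : 0 < l * (1 - l) := mul_pos hl0 (by linarith)
  by_cases hx : |x| ≤ K
  · have e := abs_le.1 hx
    have e' := abs_le.1 hd
    have h := lc_strong hl0 hl1 (R := K + M) (b := sch (K + M)) (x := x) (d := d)
      (fun z hz => Good.sch_anti (abs_le.2 hz)) ⟨by nlinarith, by nlinarith⟩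
      ⟨by nlinarith, by nlinarith⟩
    refine le_trans ?_ h
    gcongr
    have : 0 ≤ M ^ 2 / K ^ 2 * (x ^ 2 + 3) := by positivity
    linarith
  · have h := lc_strong hl0 hl1 (R := |x| + M) (b := 0) (x := x) (d := d)
      (fun z hz => (sch_pos z).le) ?_ ?_
    · refine le_trans ?_ h
      have : d ^ 2 - M ^ 2 / K ^ 2 * (x ^ 2 + 3) ≤ 0 := by
        have h1 : d ^ 2 ≤ M ^ 2 := sq_le_sq' (by linarith [(abs_le.1 hd).1]) (abs_le.1 hd).2
        have h2 : K ^ 2 ≤ x ^ 2 := by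
          rw [← sq_abs x]; exact pow_le_pow_left₀ hK.le (not_le.1 hx).le 2
        have h3 : M ^ 2 = M ^ 2 / K ^ 2 * K ^ 2 := by field_simp
        have h4 : M ^ 2 / K ^ 2 * K ^ 2 ≤ M ^ 2 / K ^ 2 * (x ^ 2 + 3) := by
          gcongr; linarith
        linarith
      have h5 : 0 ≤ sch (K + M) / 2 * (l * (1 - l)) := by positivity
      nlinarith
    · have e := abs_le.1 hd
      have e2 := neg_abs_le x
      have e3 := le_abs_self x
      exact ⟨by nlinarith, by nlinarith⟩
    · have e := abs_le.1 hd
      have e2 := neg_abs_le x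
      have e3 := le_abs_self x
      exact ⟨by nlinarith, by nlinarith⟩

/-- discrete Parisi recursion, indexed by number of remaining steps -/
def FF (m s : ℕ → ℝ) : ℕ → ℝ → ℝ
  | 0 => lc
  | r + 1 => Tn (m r) (s r) (FF m s r)

def GG (m s : ℕ → ℝ) : ℕ → ℝ → ℝ
  | 0 => tanh
  | r + 1 => Tg (m r) (s r) (FF m s r) (GG m s r)

def KK (m s : ℕ → ℝ) : ℕ → ℝ → ℝ
  | 0 => sch
  | r + 1 => Tk (m r) (s r) (FF m s r) (GG m s r) (KK m s r)

/-- cumulative variance -/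
def tt (s : ℕ → ℝ) (r : ℕ) : ℝ := ∑ i ∈ Finset.range r, s i ^ 2
def AA (a : ℕ → ℝ) (r : ℕ) : ℝ := ∑ i ∈ Finset.range r, a i
def rr (a s : ℕ → ℝ) (r : ℕ) : ℝ := ∑ i ∈ Finset.range r, AA a i ^ 2 * s i ^ 2
def t3 (s : ℕ → ℝ) (r : ℕ) : ℝ := ∑ i ∈ Finset.range r, s i ^ 3
def qf (s : ℕ → ℝ) (r : ℕ) (x : ℝ) : ℝ := exp (tt s r) * (x ^ 2 + 3)

def D8 : ℝ := 8 * B8 / b1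

lemma D8_pos : 0 < D8 := by
  have := one_le_B8; have := b1_pos
  unfold D8; positivity

lemma one_sub_ge {x : ℝ} (h0 : 0 ≤ x) (h : x ≤ 1 / 2) : exp (-2 * x) ≤ 1 - x := by
  have h1 : exp (-(2 * x)) * exp (2 * x) = 1 := by rw [← exp_add]; simp
  have h2 := add_one_le_exp (2 * x)
  rw [neg_mul]
  nlinarith [exp_pos (-(2 * x))]

lemma good_seq {m s : ℕ → ℝ} (hm : ∀ r, 0 < m r ∧ m r ≤ 1)
    (hs : ∀ r, 0 ≤ s r ∧ s r ≤ 1 / 2 ∧ D8 * s r ^ 2 ≤ 1 / 2) (r : ℕ) :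
    ∃ c, exp (-2 * D8 * tt s r) ≤ c ∧ Good c (FF m s r) (GG m s r) (KK m s r) := by
  induction r with
  | zero => exact ⟨1, by simp [tt], good_lc⟩
  | succ r ih =>
    obtain ⟨c, hc, H⟩ := ih
    have h1 := hs r
    refine ⟨_, ?_, H.step (hm r).1 (hm r).2 h1.1 (by linarith) (by
      change D8 * s r ^ 2 ≤ 1; linarith)⟩
    change _ ≤ c * (1 - D8 * s r ^ 2)
    have h2 := one_sub_ge (mul_nonneg D8_pos.le (sq_nonneg (s r))) h1.2.2
    rw [tt, Finset.sum_range_succ, mul_add, exp_add]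
    have : exp (-2 * D8 * s r ^ 2) ≤ 1 - D8 * s r ^ 2 := by rw [mul_assoc]; exact h2
    have := exp_pos (-2 * D8 * s r ^ 2)
    have := H.c0
    exact mul_le_mul hc (by assumption) (by positivity) this

lemma tt_nonneg (s : ℕ → ℝ) (r : ℕ) : 0 ≤ tt s r := Finset.sum_nonneg fun _ _ => sq_nonneg _

lemma int_lin {f1 f2 f3 : ℝ → ℝ} (h1 : Integrable f1 gm) (h2 : Integrable f2 gm)
    (h3 : Integrable f3 gm) (α b c d : ℝ) :
    ∫ w, (α + b * f1 w + c * f2 w + d * f3 w) ∂gm =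
      α + b * (∫ w, f1 w ∂gm) + c * (∫ w, f2 w ∂gm) + d * (∫ w, f3 w ∂gm) := by
  have i1 : Integrable (fun w => α + b * f1 w) gm := (integrable_const α).add (h1.const_mul b)
  have i2 : Integrable (fun w => α + b * f1 w + c * f2 w) gm := i1.add (h2.const_mul c)
  rw [integral_add i2 (h3.const_mul d), integral_add i1 (h2.const_mul c),
    integral_add (integrable_const α) (h1.const_mul b), integral_const_mul, integral_const_mul,
    integral_const_mul]
  simp

lemma sq_EG (y s : ℝ) : EG (fun w => (y + w * s) ^ 2) := (EG.id.comp_affine y s).sq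

lemma int_sq (y s : ℝ) : ∫ w, (y + w * s) ^ 2 ∂gm = y ^ 2 + s ^ 2 := by
  have := int_lin EG.id.integrable EG.id.sq.integrable (integrable_const 0) (y ^ 2) (2 * y * s)
    (s ^ 2) 0
  rw [gm_id, gm_sq] at this
  simp only [mul_zero, zero_mul, add_zero, mul_one] at this
  rw [← this]
  congr 1; ext w; ring

lemma qf_step (s : ℕ → ℝ) (r : ℕ) (hs : 0 ≤ s r) (hs1 : s r ≤ 1 / 2) {b : ℝ}
    (hb : |b| ≤ s r ^ 2) (x : ℝ) :
    ∫ w, qf s r (x + b + w * s r) ∂gm ≤ qf s (r + 1) x := by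
  have e : ∫ w, qf s r (x + b + w * s r) ∂gm = exp (tt s r) * ((x + b) ^ 2 + s r ^ 2 + 3) := by
    unfold qf
    rw [integral_const_mul, integral_add (sq_EG _ _).integrable (integrable_const _), int_sq]
    simp
  rw [e]
  unfold qf
  rw [tt, tt, Finset.sum_range_succ, exp_add, mul_assoc]
  gcongr
  have h1 := add_one_le_exp (s r ^ 2)
  have hb2 := abs_le.1 hb
  have h2 : s r ^ 2 ≤ 1 := by nlinarith
  have h3 : (x + b) ^ 2 + s r ^ 2 + 3 ≤ (s r ^ 2 + 1) * (x ^ 2 + 3) := by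
    have h4 : b ^ 2 ≤ s r ^ 2 * s r ^ 2 := by nlinarith
    have h5 : 2 * x * b ≤ s r ^ 2 * (x ^ 2 + 1) := by
      have : 2 * x * b ≤ 2 * |x| * |b| := by
        rw [mul_assoc, mul_assoc, ← abs_mul]; gcongr; exact le_abs_self _
      have : 2 * |x| * |b| ≤ 2 * |x| * s r ^ 2 := by gcongr
      nlinarith [sq_nonneg (|x| - 1), sq_abs x, sq_nonneg (s r)]
    nlinarith [sq_nonneg (s r)]
  refine h3.trans ?_
  gcongr

lemma AA_le {a s : ℕ → ℝ} (ha : ∀ r, |a r| ≤ s r ^ 2) (r : ℕ) : |AA a r| ≤ tt s r :=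
  (Finset.abs_sum_le_sum_abs _ _).trans (Finset.sum_le_sum fun i _ => ha i)

lemma rr_nonneg (a s : ℕ → ℝ) (r : ℕ) : 0 ≤ rr a s r :=
  Finset.sum_nonneg fun i _ => by positivity




/-- Gap functional -/
def Gam (l : ℝ) (f0 f1 f : ℝ → ℝ) (x d : ℝ) : ℝ :=
  (1 - l) * f0 (x - l * d) + l * f1 (x + (1 - l) * d) - f x

lemma Gam_EG {l : ℝ} {f0 f1 f : ℝ → ℝ} (h0 : EG f0) (h1 : EG f1) (h : EG f) (y d s : ℝ) :
    EG (fun w => Gam l f0 f1 f (y + w * s) d) := by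
  have e0 := (h0.comp_affine (y - l * d) s).cmul (1 - l)
  have e1 := (h1.comp_affine (y + (1 - l) * d) s).cmul l
  have := (e0.add e1).sub (h.comp_affine y s)
  refine cast (congrArg EG ?_) this
  ext w
  unfold Gam
  rw [show y - l * d + w * s = y + w * s - l * d by ring,
    show y + (1 - l) * d + w * s = y + w * s + (1 - l) * d by ring]

/-- one step of the gap -/
lemma Gam_step {l : ℝ} (hl0 : 0 < l) (hl1 : l < 1) {c0 c1 c : ℝ}
    {f0 g0 k0 f1 g1 k1 f g k : ℝ → ℝ} (H0 : Good c0 f0 g0 k0) (H1 : Good c1 f1 g1 k1)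
    (H : Good c f g k) {m0 m1 m s : ℝ} (hm0 : 0 < m0) (hm1 : 0 < m1) (hm : 0 < m) (hmm : m ≤ 1)
    (e : m = (1 - l) * m0 + l * m1) (hs : 0 ≤ s) (hs1 : s ≤ 1 / 2) (x d : ℝ) :
    (∫ w, Gam l f0 f1 f (x + m * s ^ 2 * Tg m s f g x + w * s)
      (d + (m1 - m0) * s ^ 2 * Tg m s f g x) ∂gm) - C3 * s ^ 3 ≤
    Gam l (Tn m0 s f0) (Tn m1 s f1) (Tn m s f) x d := by
  have hle := H.T_le hm hmm hs hs1 x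
  set p := Tg m s f g x
  have h0 := H0.T_ge hm0 s p (x - l * d)
  have h1 := H1.T_ge hm1 s p (x + (1 - l) * d)
  have ei : ∫ w, Gam l f0 f1 f (x + m * s ^ 2 * p + w * s) (d + (m1 - m0) * s ^ 2 * p) ∂gm =
      (1 - l) * (∫ w, f0 (x - l * d + m0 * s ^ 2 * p + w * s) ∂gm) +
      l * (∫ w, f1 (x + (1 - l) * d + m1 * s ^ 2 * p + w * s) ∂gm) -
      ∫ w, f (x + m * s ^ 2 * p + w * s) ∂gm := by
    have := int_lin (H0.fEG.comp_affine (x - l * d + m0 * s ^ 2 * p) s).integrable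
      (H1.fEG.comp_affine (x + (1 - l) * d + m1 * s ^ 2 * p) s).integrable
      (H.fEG.comp_affine (x + m * s ^ 2 * p) s).integrable 0 (1 - l) l (-1)
    rw [show ∀ A B C : ℝ, A + B - C = 0 + A + B + -1 * C from fun A B C => by ring, ← this]
    congr 1
    ext w
    unfold Gam
    rw [show x + m * s ^ 2 * p + w * s - l * (d + (m1 - m0) * s ^ 2 * p) =
        x - l * d + m0 * s ^ 2 * p + w * s by rw [e]; ring,
      show x + m * s ^ 2 * p + w * s + (1 - l) * (d + (m1 - m0) * s ^ 2 * p) =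
        x + (1 - l) * d + m1 * s ^ 2 * p + w * s by rw [e]; ring]
    ring
  rw [ei]
  unfold Gam
  have h0' := mul_le_mul_of_nonneg_left h0 (sub_nonneg.2 hl1.le)
  have h1' := mul_le_mul_of_nonneg_left h1 hl0.le
  have e3 : m / 2 * s ^ 2 * p ^ 2 = (1 - l) * (m0 / 2 * s ^ 2 * p ^ 2) +
    l * (m1 / 2 * s ^ 2 * p ^ 2) := by rw [e]; ring
  linarith

/-- barrier -/
def vf (κ K' L : ℝ) (A ρ G Q d : ℝ) : ℝ :=
  (d + A * G) ^ 2 + κ * ρ * (1 - Q / K' ^ 2) - L * Q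

lemma qf_ge (s : ℕ → ℝ) (r : ℕ) (x : ℝ) : x ^ 2 + 3 ≤ qf s r x := by
  unfold qf
  have := one_le_exp (tt_nonneg s r)
  nlinarith [sq_nonneg x]

lemma qf_EG (s : ℕ → ℝ) (r : ℕ) (y b : ℝ) : EG (fun w => qf s r (y + w * b)) :=
  ((sq_EG y b).add (EG.const 3)).cmul _

/-- one step of the barrier -/
lemma vf_step {κ K' L M : ℝ} (hκ : 0 ≤ κ) (hK' : 0 < K') (hL : 0 ≤ L)
    {c : ℝ} {f g k : ℝ → ℝ} (H : Good c f g k) (hc : κ ≤ (c * sch (K' + 2)) ^ 2 * Good.qq)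
    {m : ℝ} (hm : 0 < m) (hmm : m ≤ 1) (s : ℕ → ℝ) (r : ℕ)
    (hs : 0 ≤ s r) (hs1 : s r ≤ 1 / 2) {A a ρ : ℝ} (hρ : 0 ≤ ρ) (hA : |A| ≤ M)
    (x d : ℝ) (hd : |d + (A + a) * Tg m (s r) f g x| ≤ 2 * M) :
    vf κ K' L (A + a) (ρ + A ^ 2 * s r ^ 2) (Tg m (s r) f g x) (qf s (r + 1) x) d
      - 4 * M ^ 2 * C3 * s r ^ 3 ≤
    ∫ w, vf κ K' L A ρ (g (x + m * s r ^ 2 * Tg m (s r) f g x + w * s r))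
      (qf s r (x + m * s r ^ 2 * Tg m (s r) f g x + w * s r))
      (d + a * Tg m (s r) f g x) ∂gm := by
  have hmart := H.mart hm hmm hs hs1 x
  have hp1 := H.Tg_le hm (s r) x
  set p := Tg m (s r) f g x
  have hb : |m * s r ^ 2 * p| ≤ s r ^ 2 := by
    rw [abs_mul, abs_mul, abs_of_pos hm, abs_of_nonneg (sq_nonneg _)]
    calc m * s r ^ 2 * |p| ≤ 1 * s r ^ 2 * 1 := by gcongr
      _ = _ := by ring
  have hq := qf_step s r hs hs1 hb x
  set y := x + m * s r ^ 2 * p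
  have hg := H.gEG.comp_affine y (s r)
  have hvar : κ * s r ^ 2 * (1 - qf s (r + 1) x / K' ^ 2) ≤
      ∫ w, (g (y + w * s r) - p) ^ 2 ∂gm := by
    by_cases hx : |x| ≤ K'
    · have hy : |y| ≤ K' + 1 := by
        refine (abs_add_le _ _).trans ?_
        nlinarith
      have := H.var_ge hs hs1 y p (K' + 1) hy
      refine le_trans ?_ this
      rw [show K' + 1 + 1 = K' + 2 by ring]
      have h1 : κ * s r ^ 2 * (1 - qf s (r + 1) x / K' ^ 2) ≤ κ * s r ^ 2 * 1 := by
        gcongr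
        have : 0 ≤ qf s (r + 1) x / K' ^ 2 := by
          have := qf_ge s (r + 1) x
          have : 0 ≤ qf s (r + 1) x := by nlinarith [sq_nonneg x]
          positivity
        linarith
      refine h1.trans ?_
      rw [mul_one]
      gcongr
    · have h1 : 1 ≤ qf s (r + 1) x / K' ^ 2 := by
        rw [le_div_iff₀ (by positivity), one_mul]
        have h2 : K' ^ 2 ≤ x ^ 2 := by
          rw [← sq_abs x]; exact pow_le_pow_left₀ hK'.le (not_le.1 hx).le 2
        linarith [qf_ge s (r + 1) x]
      have h2 : κ * s r ^ 2 * (1 - qf s (r + 1) x / K' ^ 2) ≤ 0 :=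
        mul_nonpos_of_nonneg_of_nonpos (by positivity) (by linarith)
      exact h2.trans (integral_nonneg fun w => sq_nonneg _)
  set D := d + (A + a) * p with hD
  set Q1 := qf s (r + 1) x
  set Qi := ∫ w, qf s r (y + w * s r) ∂gm with hQi
  set V := ∫ w, (g (y + w * s r) - p) ^ 2 ∂gm with hV
  set E := ∫ w, g (y + w * s r) ∂gm with hE
  have ei : ∫ w, vf κ K' L A ρ (g (y + w * s r)) (qf s r (y + w * s r)) (d + a * p) ∂gm =
      (D ^ 2 - 2 * D * A * p + κ * ρ) + 2 * D * A * E + A ^ 2 * V +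
        (-(κ * ρ / K' ^ 2) - L) * Qi := by
    have := int_lin hg.integrable (hg.sub (EG.const p)).sq.integrable
      (qf_EG s r y (s r)).integrable (D ^ 2 - 2 * D * A * p + κ * ρ) (2 * D * A) (A ^ 2)
      (-(κ * ρ / K' ^ 2) - L)
    rw [← hE, ← hV, ← hQi] at this
    rw [← this]
    congr 1
    ext w
    unfold vf
    rw [hD]
    ring
  rw [ei]
  unfold vf
  have h1 : 0 ≤ κ * ρ / K' ^ 2 := by positivity
  have h2 : (κ * ρ / K' ^ 2 + L) * Qi ≤ (κ * ρ / K' ^ 2 + L) * Q1 := by gcongr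
  have h3 : -(4 * M ^ 2 * C3 * s r ^ 3) ≤ 2 * D * A * (E - p) := by
    have hM : 0 ≤ M := (abs_nonneg _).trans hA
    have : |2 * D * A * (E - p)| ≤ 2 * (2 * M) * M * (C3 * s r ^ 3) := by
      rw [abs_mul, abs_mul, abs_mul]
      simp only [abs_two]
      gcongr
    have := neg_abs_le (2 * D * A * (E - p))
    linarith
  have h4 := mul_le_mul_of_nonneg_left hvar (sq_nonneg A)
  rw [← hD]
  have e5 : κ * (ρ + A ^ 2 * s r ^ 2) * (1 - Q1 / K' ^ 2) =
    κ * ρ - κ * ρ / K' ^ 2 * Q1 + A ^ 2 * (κ * s r ^ 2 * (1 - Q1 / K' ^ 2)) := by ring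
  rw [e5]
  linarith

lemma int_aff {f : ℝ → ℝ} (hf : Integrable f gm) (C b e : ℝ) :
    ∫ w, (C * (f w - b) - e) ∂gm = C * ((∫ w, f w ∂gm) - b) - e := by
  have h1 : Integrable (fun w => f w - b) gm := hf.sub (integrable_const b)
  rw [integral_sub (h1.const_mul C) (integrable_const e), integral_const_mul,
    integral_sub hf (integrable_const b)]
  simp

lemma gap_main {l : ℝ} (hl0 : 0 < l) (hl1 : l < 1) {M K K' κ : ℝ} (hM : 0 ≤ M) (hK : 0 < K)
    (hK' : 0 < K') (hκ : 0 ≤ κ)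
    (hκ2 : κ ≤ (exp (-2 * D8 * M) * sch (K' + 2)) ^ 2 * Good.qq)
    {m0 m1 m s : ℕ → ℝ} (hm0 : ∀ r, 0 < m0 r ∧ m0 r ≤ 1) (hm1 : ∀ r, 0 < m1 r ∧ m1 r ≤ 1)
    (hm : ∀ r, m r = (1 - l) * m0 r + l * m1 r)
    (hs : ∀ r, 0 ≤ s r ∧ s r ≤ 1 / 2 ∧ D8 * s r ^ 2 ≤ 1 / 2)
    (htt : ∀ r, tt s r ≤ M) (r : ℕ) :
    ∀ x d, |d| ≤ M - tt s r →
      sch (K + M) / 2 * (l * (1 - l)) *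
        (vf κ K' (M ^ 2 / K ^ 2) (AA (fun i => (m1 i - m0 i) * s i ^ 2) r)
          (rr (fun i => (m1 i - m0 i) * s i ^ 2) s r) (GG m s r x) (qf s r x) d
          - 4 * M ^ 2 * C3 * t3 s r) - C3 * t3 s r ≤
      Gam l (FF m0 s r) (FF m1 s r) (FF m s r) x d := by
  have hll : 0 < l * (1 - l) := mul_pos hl0 (by linarith)
  have hsch := sch_pos (K + M)
  have hC : 0 ≤ sch (K + M) / 2 * (l * (1 - l)) := by positivity
  have hmr : ∀ r, 0 < m r ∧ m r ≤ 1 := fun r => by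
    rw [hm]
    constructor
    · nlinarith [(hm0 r).1, (hm1 r).1]
    · nlinarith [(hm0 r).2, (hm1 r).2]
  have ha : ∀ r, |(fun i => (m1 i - m0 i) * s i ^ 2) r| ≤ s r ^ 2 := fun r => by
    simp only [abs_mul, abs_of_nonneg (sq_nonneg (s r))]
    have : |m1 r - m0 r| ≤ 1 :=
      abs_le.2 ⟨by linarith [(hm0 r).2, (hm1 r).1], by linarith [(hm1 r).2, (hm0 r).1]⟩
    nlinarith [sq_nonneg (s r)]
  set a : ℕ → ℝ := fun i => (m1 i - m0 i) * s i ^ 2 with hadef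
  induction r with
  | zero =>
    intro x d hd
    have h := lc_terminal hl0 hl1 hK hM (x := x) (d := d) (by simpa [tt] using hd)
    unfold Gam
    simp only [FF]
    refine le_trans (le_of_eq ?_) h
    simp [vf, AA, rr, t3, qf, tt]
  | succ r ih =>
    intro x d hd
    obtain ⟨c0, -, H0⟩ := good_seq hm0 hs r
    obtain ⟨c1, -, H1⟩ := good_seq hm1 hs r
    obtain ⟨c, hc, H⟩ := good_seq hmr hs r
    have hp1 := H.Tg_le (hmr r).1 (s r) x
    have hstep := Gam_step hl0 hl1 H0 H1 H (hm0 r).1 (hm1 r).1 (hmr r).1 (hmr r).2 (hm r)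
      (hs r).1 (hs r).2.1 x d
    have httr : tt s (r + 1) = tt s r + s r ^ 2 := Finset.sum_range_succ _ _
    have hAr : AA a (r + 1) = AA a r + a r := Finset.sum_range_succ _ _
    have hrr : rr a s (r + 1) = rr a s r + AA a r ^ 2 * s r ^ 2 := Finset.sum_range_succ _ _
    have ht3 : t3 s (r + 1) = t3 s r + s r ^ 3 := Finset.sum_range_succ _ _
    have hG : GG m s (r + 1) x = Tg (m r) (s r) (FF m s r) (GG m s r) x := rfl
    have hA1 := AA_le ha r
    have hA2 := AA_le ha (r + 1)
    have hcc : κ ≤ (c * sch (K' + 2)) ^ 2 * Good.qq := by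
      refine hκ2.trans ?_
      have := sch_pos (K' + 2)
      have := Good.qq_pos
      gcongr
      refine le_trans ?_ hc
      apply exp_le_exp.2
      have := D8_pos
      nlinarith [htt r]
    have hv := vf_step (M := M) hκ hK' (L := M ^ 2 / K ^ 2) (by positivity) H hcc (hmr r).1 (hmr r).2 s r
      (hs r).1 (hs r).2.1 (A := AA a r) (a := a r) (rr_nonneg a s r) (hA1.trans (htt r)) x d (by
        rw [← hAr]
        refine (abs_add_le _ _).trans ?_
        rw [abs_mul]
        have h1 : |AA a (r + 1)| * |Tg (m r) (s r) (FF m s r) (GG m s r) x| ≤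
          tt s (r + 1) * 1 := by
          gcongr
          exact tt_nonneg s _
        linarith [tt_nonneg s (r + 1)])
    rw [← hAr, ← hrr, ← hG] at hv
    rw [← hG] at hstep hp1
    set p := GG m s (r + 1) x
    have hd' : |d + a r * p| ≤ M - tt s r := by
      refine (abs_add_le _ _).trans ?_
      rw [abs_mul]
      have : |a r| * |p| ≤ s r ^ 2 * 1 := by
        gcongr
        exact ha r
      linarith
    have hmono : ∫ w, (sch (K + M) / 2 * (l * (1 - l)) *
        (vf κ K' (M ^ 2 / K ^ 2) (AA a r) (rr a s r)
          (GG m s r (x + m r * s r ^ 2 * p + w * s r))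
          (qf s r (x + m r * s r ^ 2 * p + w * s r)) (d + a r * p)
          - 4 * M ^ 2 * C3 * t3 s r) - C3 * t3 s r) ∂gm ≤
        ∫ w, Gam l (FF m0 s r) (FF m1 s r) (FF m s r) (x + m r * s r ^ 2 * p + w * s r)
          (d + a r * p) ∂gm := by
      refine integral_mono ?_ (Gam_EG H0.fEG H1.fEG H.fEG _ _ _).integrable
        fun w => ih _ _ hd'
      have hg := H.gEG.comp_affine (x + m r * s r ^ 2 * p) (s r)
      have hq := qf_EG s r (x + m r * s r ^ 2 * p) (s r)
      have hEG : EG (fun w => vf κ K' (M ^ 2 / K ^ 2) (AA a r) (rr a s r)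
          (GG m s r (x + m r * s r ^ 2 * p + w * s r))
          (qf s r (x + m r * s r ^ 2 * p + w * s r)) (d + a r * p)) := by
        have := (((EG.const (d + a r * p)).add (hg.cmul (AA a r))).sq.add
          (((EG.const 1).sub (hq.cmul (K' ^ 2)⁻¹)).cmul (κ * rr a s r))).sub
          (hq.cmul (M ^ 2 / K ^ 2))
        refine cast (congrArg EG ?_) this
        ext w
        unfold vf
        ring
      exact (((hEG.sub (EG.const _)).cmul _).sub (EG.const _)).integrable
    have hvint : Integrable (fun w => vf κ K' (M ^ 2 / K ^ 2) (AA a r) (rr a s r)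
          (GG m s r (x + m r * s r ^ 2 * p + w * s r))
          (qf s r (x + m r * s r ^ 2 * p + w * s r)) (d + a r * p)) gm := by
      have hg := H.gEG.comp_affine (x + m r * s r ^ 2 * p) (s r)
      have hq := qf_EG s r (x + m r * s r ^ 2 * p) (s r)
      have := (((EG.const (d + a r * p)).add (hg.cmul (AA a r))).sq.add
          (((EG.const 1).sub (hq.cmul (K' ^ 2)⁻¹)).cmul (κ * rr a s r))).sub
          (hq.cmul (M ^ 2 / K ^ 2))
      refine this.integrable.congr (Eventually.of_forall fun w => ?_)
      simp only [vf]
      ring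
    rw [int_aff hvint] at hmono
    change _ ≤ Gam l (Tn _ _ _) (Tn _ _ _) (Tn _ _ _) x d
    refine le_trans ?_ hstep
    have hmul := mul_le_mul_of_nonneg_left hv hC
    rw [ht3]
    refine le_trans ?_ (sub_le_sub_right hmono _)
    linarith




lemma gap_unif {l : ℝ} (hl0 : 0 < l) (hl1 : l < 1) {M : ℝ} (hM : 0 ≤ M) (h : ℝ) {η : ℝ}
    (hη : 0 < η) : ∃ δ > 0, ∃ sb > 0, ∀ m0 m1 m s : ℕ → ℝ,
      (∀ r, 0 < m0 r ∧ m0 r ≤ 1) → (∀ r, 0 < m1 r ∧ m1 r ≤ 1) →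
      (∀ r, m r = (1 - l) * m0 r + l * m1 r) → (∀ r, 0 ≤ s r ∧ s r ≤ sb) →
      (∀ r, tt s r ≤ M) → ∀ r, η ≤ rr (fun i => (m1 i - m0 i) * s i ^ 2) s r →
      δ ≤ (1 - l) * FF m0 s r h + l * FF m1 s r h - FF m s r h := by
  set Q := exp M * (h ^ 2 + 3) with hQ
  have hQ0 : 0 < Q := by positivity
  set K' := sqrt (2 * Q) with hK'
  have hK'0 : 0 < K' := sqrt_pos.2 (by positivity)
  have hK'2 : K' ^ 2 = 2 * Q := sq_sqrt (by positivity)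
  set κ := (exp (-2 * D8 * M) * sch (K' + 2)) ^ 2 * Good.qq with hκ
  have hκ0 : 0 < κ := by
    have := Good.qq_pos; have := sch_pos (K' + 2); positivity
  set K := sqrt (4 * M ^ 2 * Q / (κ * η) + 1) with hK
  have hK0 : 0 < K := sqrt_pos.2 (by positivity)
  have hK2 : K ^ 2 = 4 * M ^ 2 * Q / (κ * η) + 1 := sq_sqrt (by positivity)
  have hLQ : M ^ 2 / K ^ 2 * Q ≤ κ * η / 4 := by
    rw [div_mul_eq_mul_div, div_le_iff₀ (by positivity), hK2]
    have : κ * η / 4 * (4 * M ^ 2 * Q / (κ * η) + 1) = M ^ 2 * Q + κ * η / 4 := by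
      field_simp
    rw [this]
    have : 0 < κ * η / 4 := by positivity
    linarith
  set e := sch (K + M) / 2 * (l * (1 - l)) with he
  have he0 : 0 < e := by
    have := sch_pos (K + M)
    have : 0 < 1 - l := by linarith
    positivity
  have hC3 := C3_pos
  have hD8 := D8_pos
  set Z := (e * (4 * M ^ 2 * C3) + C3) * (M + 1) with hZ
  have hZ0 : 0 < Z := by positivity
  refine ⟨e * (κ * η) / 8, by positivity, min (1 / 2) (min (1 / D8) (e * (κ * η) / 8 / Z)),
    by positivity, ?_⟩
  intro m0 m1 m s hm0 hm1 hm hs htt r hr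
  have hs' : ∀ r, 0 ≤ s r ∧ s r ≤ 1 / 2 ∧ D8 * s r ^ 2 ≤ 1 / 2 := fun r => by
    obtain ⟨h0, h1⟩ := hs r
    have h2 := h1.trans (min_le_left _ _)
    have h3 := h1.trans ((min_le_right _ _).trans (min_le_left _ _))
    rw [le_div_iff₀ hD8] at h3
    refine ⟨h0, h2, ?_⟩
    nlinarith
  have main := gap_main hl0 hl1 hM hK0 hK'0 hκ0.le le_rfl hm0 hm1 hm hs' htt r h 0
    (by simpa using htt r)
  have hq1 : qf s r h ≤ Q := by
    unfold qf
    rw [hQ]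
    gcongr
    exact htt r
  have hv : κ * η / 4 ≤ vf κ K' (M ^ 2 / K ^ 2) (AA (fun i => (m1 i - m0 i) * s i ^ 2) r)
          (rr (fun i => (m1 i - m0 i) * s i ^ 2) s r) (GG m s r h) (qf s r h) 0 := by
    unfold vf
    have h1 : 1 / 2 ≤ 1 - qf s r h / K' ^ 2 := by
      have : qf s r h / K' ^ 2 ≤ 1 / 2 := by
        rw [div_le_iff₀ (by positivity), hK'2]; linarith
      linarith
    have h2 : κ * η * (1 / 2) ≤ κ * rr (fun i => (m1 i - m0 i) * s i ^ 2) s r *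
      (1 - qf s r h / K' ^ 2) := by
      gcongr
      have := rr_nonneg (fun i => (m1 i - m0 i) * s i ^ 2) s r
      positivity
    have h3 : M ^ 2 / K ^ 2 * qf s r h ≤ M ^ 2 / K ^ 2 * Q := by gcongr
    have h4 := sq_nonneg (0 + AA (fun i => (m1 i - m0 i) * s i ^ 2) r * GG m s r h)
    linarith
  have ht3 : Z / (M + 1) * t3 s r ≤ e * (κ * η) / 8 := by
    have h1 : t3 s r ≤ (e * (κ * η) / 8 / Z) * tt s r := by
      unfold t3 tt
      rw [Finset.mul_sum]
      refine Finset.sum_le_sum fun i _ => ?_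
      have h3 := (hs i).2.trans ((min_le_right _ _).trans (min_le_right _ _))
      rw [pow_succ, mul_comm]
      gcongr
    have h2 : (e * (κ * η) / 8 / Z) * tt s r ≤ (e * (κ * η) / 8 / Z) * (M + 1) := by
      gcongr
      linarith [htt r]
    calc Z / (M + 1) * t3 s r ≤ Z / (M + 1) * ((e * (κ * η) / 8 / Z) * (M + 1)) := by
          gcongr; exact h1.trans h2
      _ = e * (κ * η) / 8 := by field_simp
  have hZ2 : Z / (M + 1) = e * (4 * M ^ 2 * C3) + C3 := by
    rw [hZ]; field_simp
  rw [hZ2] at ht3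
  have hv2 := mul_le_mul_of_nonneg_left hv he0.le
  simp only [Gam, mul_zero, sub_zero, add_zero] at main
  rw [← he] at main
  have hp : 0 < e * (κ * η) := by positivity
  clear_value e
  linarith

lemma sum_diff (f : ℕ → ℝ) {p q : ℕ} (h : p ≤ q) :
    ∑ i ∈ Finset.range q, f i = ∑ i ∈ Finset.range p, f i + ∑ i ∈ Finset.Ico p q, f i := by
  rw [Finset.sum_range_add_sum_Ico _ h]

lemma rr_lower_pos {a s : ℕ → ℝ} {p q u v N : ℕ} (h1 : p ≤ q) (h2 : q ≤ u) (h3 : u ≤ v)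
    (h4 : v ≤ N) {ε D : ℝ} (hε : 0 ≤ ε) (hD : 0 ≤ D)
    (ha : ∀ i, p ≤ i → i < v → ε * s i ^ 2 ≤ a i)
    (d1 : D ≤ tt s q - tt s p) (d2 : D ≤ tt s u - tt s q) (d3 : D ≤ tt s v - tt s u) :
    (ε * D / 2) ^ 2 * D ≤ rr a s N := by
  have hAdiff : ∀ i j, p ≤ i → i ≤ j → j ≤ v → ε * (tt s j - tt s i) ≤ AA a j - AA a i := by
    intro i j hi hij hj
    unfold tt AA
    rw [sum_diff _ hij, sum_diff a hij, add_sub_cancel_left, add_sub_cancel_left, Finset.mul_sum]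
    refine Finset.sum_le_sum fun k hk => ?_
    rw [Finset.mem_Ico] at hk
    exact ha k (hi.trans hk.1) (by omega)
  have hmono : ∀ i j, i ≤ j → tt s i ≤ tt s j := fun i j hij => by
    unfold tt
    exact Finset.sum_le_sum_of_subset_of_nonneg (by simpa using hij) fun _ _ _ => sq_nonneg _
  have hAmono : ∀ i j, p ≤ i → i ≤ j → j ≤ v → AA a i ≤ AA a j := fun i j hi hij hj => by
    have := hAdiff i j hi hij hj
    have := mul_nonneg hε (sub_nonneg.2 (hmono i j hij))
    linarith
  have hsub : ∀ i j, i ≤ j → j ≤ N → (∀ k, i ≤ k → k < j → (ε * D / 2) ^ 2 ≤ AA a k ^ 2) →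
      D ≤ tt s j - tt s i → (ε * D / 2) ^ 2 * D ≤ rr a s N := by
    intro i j hij hj hk hd
    calc (ε * D / 2) ^ 2 * D ≤ (ε * D / 2) ^ 2 * (tt s j - tt s i) := by gcongr
      _ = ∑ k ∈ Finset.Ico i j, (ε * D / 2) ^ 2 * s k ^ 2 := by
        unfold tt
        rw [sum_diff _ hij, add_sub_cancel_left, Finset.mul_sum]
      _ ≤ ∑ k ∈ Finset.Ico i j, AA a k ^ 2 * s k ^ 2 := by
        refine Finset.sum_le_sum fun k hk' => ?_
        rw [Finset.mem_Ico] at hk'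
        gcongr ?_ * _
        exact hk k hk'.1 hk'.2
      _ ≤ rr a s N := by
        refine Finset.sum_le_sum_of_subset_of_nonneg ?_ fun _ _ _ => by positivity
        intro k hk
        simp only [Finset.mem_Ico, Finset.mem_range] at *
        omega
  have hmid := hAdiff q u h1 h2 h3
  have hmid2 : ε * D ≤ ε * (tt s u - tt s q) := by gcongr
  have hn : 0 ≤ ε * D / 2 := by positivity
  by_cases hc : ε * D / 2 ≤ AA a u
  · refine hsub u v h3 h4 (fun k hk1 hk2 => ?_) d3
    have := hAmono u k (h1.trans h2) hk1 hk2.le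
    exact pow_le_pow_left₀ hn (by linarith) 2
  · refine hsub p q h1 (by omega) (fun k hk1 hk2 => ?_) d1
    have := hAmono k q hk1 hk2.le (by omega)
    rw [← neg_sq (AA a k)]
    exact pow_le_pow_left₀ hn (by linarith) 2

lemma rr_neg (a s : ℕ → ℝ) (r : ℕ) : rr (fun i => -a i) s r = rr a s r := by
  simp [rr, AA]




lemma sq_le_two_pow (p : ℕ) : ((p : ℝ)) ^ 2 ≤ 2 * 2 ^ p := by
  have : p ^ 2 ≤ 2 * 2 ^ p := by
    induction p with
    | zero => simp
    | succ n ih =>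
      rcases n with _ | _ | _ | n
      · simp
      · simp
      · simp
      · have e : 2 ^ (n + 1 + 1 + 1 + 1) = 2 ^ (n + 1 + 1 + 1) * 2 := pow_succ _ _
        rw [e]
        have e2 : (n + 1 + 1 + 1 + 1) ^ 2 ≤ 2 * (n + 1 + 1 + 1) ^ 2 := by
          ring_nf
          omega
        omega
  exact_mod_cast this

lemma summ2 {β : ℕ → ℝ} (hβ : ValidBeta β) : Summable fun p : ℕ => (p : ℝ) ^ 2 * β p ^ 2 := by
  refine Summable.of_nonneg_of_le (fun p => by positivity) (fun p => ?_) (hβ.2.2.2.2.mul_left 2)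
  have := sq_le_two_pow p
  rw [← mul_assoc]
  gcongr

lemma summD {β : ℕ → ℝ} (hβ : ValidBeta β) {s : ℝ} (hs : s ∈ Icc (0 : ℝ) 1) :
    Summable fun p : ℕ => (p : ℝ) * β p ^ 2 * s ^ (p - 1) := by
  refine Summable.of_nonneg_of_le (fun p => ?_) (fun p => ?_) (summ2 hβ)
  · have := hs.1; positivity
  · have h1 : s ^ (p - 1) ≤ 1 := pow_le_one₀ hs.1 hs.2
    have h2 : (p : ℝ) ≤ p ^ 2 := by
      rcases p with _ | p
      · simp
      · push_cast; nlinarith [(Nat.cast_nonneg p : (0:ℝ) ≤ p)]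
    calc (p : ℝ) * β p ^ 2 * s ^ (p - 1) ≤ (p : ℝ) ^ 2 * β p ^ 2 * 1 := by
          have := hs.1
          gcongr
      _ = _ := mul_one _

def LL (β : ℕ → ℝ) : ℝ := ∑' p : ℕ, (p : ℝ) ^ 2 * β p ^ 2

lemma LL_nonneg (β : ℕ → ℝ) : 0 ≤ LL β := tsum_nonneg fun p => by positivity

lemma pow_diff_le {s t : ℝ} (hs : 0 ≤ s) (hst : s ≤ t) (ht : t ≤ 1) (n : ℕ) :
    t ^ n - s ^ n ≤ n * (t - s) := by
  induction n with
  | zero => simp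
  | succ n ih =>
    have h1 : t ^ n ≤ 1 := pow_le_one₀ (hs.trans hst) ht
    have h2 : s ^ n ≤ t ^ n := pow_le_pow_left₀ hs hst n
    rw [pow_succ, pow_succ]
    push_cast
    nlinarith [pow_nonneg hs n]

lemma xiD_lip {β : ℕ → ℝ} (hβ : ValidBeta β) {s t : ℝ} (hs : 0 ≤ s) (hst : s ≤ t) (ht : t ≤ 1) :
    xiD β t - xiD β s ≤ LL β * (t - s) := by
  unfold xiD LL
  rw [← (summD hβ ⟨hs.trans hst, ht⟩).tsum_sub (summD hβ ⟨hs, hst.trans ht⟩), ← tsum_mul_right]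
  refine Summable.tsum_le_tsum (fun p => ?_)
    ((summD hβ ⟨hs.trans hst, ht⟩).sub (summD hβ ⟨hs, hst.trans ht⟩)) ((summ2 hβ).mul_right _)
  rw [← mul_sub]
  have h1 := pow_diff_le hs hst ht (p - 1)
  have h2 : ((p - 1 : ℕ) : ℝ) ≤ p := by exact_mod_cast Nat.sub_le p 1
  have h3 : t ^ (p - 1) - s ^ (p - 1) ≤ p * (t - s) := h1.trans (by gcongr)
  calc _ ≤ (p : ℝ) * β p ^ 2 * (p * (t - s)) := by gcongr
    _ = _ := by ring

lemma xiD_strict {β : ℕ → ℝ} (hβ : ValidBeta β) {s t : ℝ} (hs : 0 ≤ s) (hst : s < t) (ht : t ≤ 1) :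
    xiD β s < xiD β t := by
  obtain ⟨p, hp, hbp⟩ := hβ.2.2.2.1
  unfold xiD
  refine Summable.tsum_lt_tsum (i := p) (fun q => ?_) ?_
    (summD hβ ⟨hs, hst.le.trans ht⟩) (summD hβ ⟨hs.trans hst.le, ht⟩)
  · gcongr
  · have : (0 : ℝ) < p := by exact_mod_cast (by omega : 0 < p)
    have h2 : s ^ (p - 1) < t ^ (p - 1) := pow_lt_pow_left₀ hst hs (by omega)
    gcongr

lemma xiD_mono {β : ℕ → ℝ} (hβ : ValidBeta β) {s t : ℝ} (hs : 0 ≤ s) (hst : s ≤ t) (ht : t ≤ 1) :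
    xiD β s ≤ xiD β t := by
  rcases hst.eq_or_lt with h | h
  · rw [h]
  · exact (xiD_strict hβ hs h ht).le

lemma xiD_zero {β : ℕ → ℝ} (hβ : ValidBeta β) : xiD β 0 = 0 := by
  unfold xiD
  rw [show (fun p : ℕ => (p : ℝ) * β p ^ 2 * (0 : ℝ) ^ (p - 1)) = fun _ => 0 from ?_, tsum_zero]
  ext p
  rcases p with _ | _ | p
  · simp
  · simp [hβ.2.1]
  · simp

/-- grid data -/
def gs (β : ℕ → ℝ) (N r : ℕ) : ℝ :=
  sqrt (xiD β (((N - r : ℕ) : ℝ) / N) - xiD β (((N - (r + 1) : ℕ) : ℝ) / N))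

lemma grid_mem (N k : ℕ) : 0 ≤ (((N - k : ℕ) : ℝ) / N) ∧ (((N - k : ℕ) : ℝ) / N) ≤ 1 := by
  refine ⟨by positivity, div_le_one_of_le₀ ?_ (Nat.cast_nonneg _)⟩
  exact_mod_cast Nat.sub_le N k

lemma grid_le (N : ℕ) {i j : ℕ} (h : i ≤ j) :
    (((N - j : ℕ) : ℝ) / N) ≤ (((N - i : ℕ) : ℝ) / N) := by
  gcongr

lemma gs_sq {β : ℕ → ℝ} (hβ : ValidBeta β) (N r : ℕ) : gs β N r ^ 2 =
    xiD β (((N - r : ℕ) : ℝ) / N) - xiD β (((N - (r + 1) : ℕ) : ℝ) / N) :=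
  sq_sqrt (sub_nonneg.2 (xiD_mono hβ (grid_mem N _).1 (grid_le N (Nat.le_succ r))
    (grid_mem N _).2))

lemma tt_gs {β : ℕ → ℝ} (hβ : ValidBeta β) {N : ℕ} (hN : 0 < N) (r : ℕ) :
    tt (gs β N) r = xiD β 1 - xiD β (((N - r : ℕ) : ℝ) / N) := by
  have hN' : (N : ℝ) ≠ 0 := by exact_mod_cast hN.ne'
  induction r with
  | zero => simp [tt, div_self hN']
  | succ r ih =>
    have : tt (gs β N) (r + 1) = tt (gs β N) r + gs β N r ^ 2 := Finset.sum_range_succ _ _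
    rw [this, ih, gs_sq hβ]
    ring

lemma tt_gs_le {β : ℕ → ℝ} (hβ : ValidBeta β) {N : ℕ} (hN : 0 < N) (r : ℕ) :
    tt (gs β N) r ≤ xiD β 1 := by
  rw [tt_gs hβ hN]
  have := xiD_mono hβ le_rfl (grid_mem N r).1 (grid_mem N r).2
  rw [xiD_zero hβ] at this
  linarith

lemma gs_le {β : ℕ → ℝ} (hβ : ValidBeta β) {N : ℕ} (hN : 0 < N) (r : ℕ) :
    gs β N r ≤ sqrt (LL β / N) := by
  refine sqrt_le_sqrt ?_
  refine (xiD_lip hβ (grid_mem N _).1 (grid_le N (Nat.le_succ r)) (grid_mem N _).2).trans ?_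
  rw [div_eq_mul_inv (LL β), ← sub_div, div_eq_mul_inv _ (N : ℝ)]
  have : ((N - r : ℕ) : ℝ) ≤ ((N - (r + 1) : ℕ) : ℝ) + 1 := by exact_mod_cast (by omega)
  have h2 : ((N - r : ℕ) : ℝ) - ((N - (r + 1) : ℕ) : ℝ) ≤ 1 := by linarith
  have := LL_nonneg β
  have h3 : (((N - r : ℕ) : ℝ) - ((N - (r + 1) : ℕ) : ℝ)) * (N : ℝ)⁻¹ ≤ 1 * (N : ℝ)⁻¹ := by
    gcongr
  rw [one_mul] at h3
  gcongr




lemma MemM.prob {μ : Measure ℝ} (h : MemM μ) : IsProbabilityMeasure μ := h.1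

lemma MemM.ae {μ : Measure ℝ} (h : MemM μ) : ∀ᵐ x ∂μ, x ∈ Icc (0 : ℝ) 1 := h.2

lemma distF_eq_cdf {μ : Measure ℝ} (h : MemM μ) (s : ℝ) : distF μ s = cdf μ s := by
  have := h.1
  rw [cdf_eq_real, distF, measureReal_def]
  congr 1
  apply measure_congr
  filter_upwards [h.ae] with x hx
  apply propext
  exact ⟨fun hx' => hx'.2, fun hx' => ⟨hx.1, hx'⟩⟩

lemma distF_mono {μ : Measure ℝ} [IsFiniteMeasure μ] : Monotone (distF μ) := fun _ _ h =>
  ENNReal.toReal_mono (measure_ne_top _ _) (measure_mono (Icc_subset_Icc_right h))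

lemma distF_nonneg (μ : Measure ℝ) (s : ℝ) : 0 ≤ distF μ s := ENNReal.toReal_nonneg

lemma distF_le_one {μ : Measure ℝ} (h : MemM μ) (s : ℝ) : distF μ s ≤ 1 := by
  have := h.1
  exact measureReal_le_one

/-- grid rounding -/
def cN (N : ℕ) (x : ℝ) : ℝ := (⌈(N : ℝ) * x⌉ : ℝ) / N

lemma cN_meas (N : ℕ) : Measurable (cN N) := by
  unfold cN
  exact ((measurable_from_top (f := fun z : ℤ => (z : ℝ))).comp
    (Int.measurable_ceil.comp (measurable_const.mul measurable_id))).div_const _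

lemma cN_le {N : ℕ} (hN : 0 < N) (x s : ℝ) : cN N x ≤ s ↔ x ≤ (⌊(N : ℝ) * s⌋ : ℝ) / N := by
  have hN' : (0 : ℝ) < N := by exact_mod_cast hN
  unfold cN
  rw [div_le_iff₀ hN', le_div_iff₀ hN', mul_comm s, mul_comm x, ← Int.le_floor, Int.ceil_le]

lemma cN_mem {N : ℕ} (hN : 0 < N) {x : ℝ} (hx : x ∈ Icc (0 : ℝ) 1) :
    ∃ j : ℕ, j ≤ N ∧ cN N x = (j : ℝ) / N := by
  have hN' : (0 : ℝ) < N := by exact_mod_cast hN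
  have h0 : 0 ≤ ⌈(N : ℝ) * x⌉ := Int.ceil_nonneg (mul_nonneg hN'.le hx.1)
  have h1 : ⌈(N : ℝ) * x⌉ ≤ N := by
    rw [Int.ceil_le]
    push_cast
    nlinarith [hx.2]
  refine ⟨⌈(N : ℝ) * x⌉.toNat, by omega, ?_⟩
  unfold cN
  congr 1
  have : ((⌈(N : ℝ) * x⌉.toNat : ℤ) : ℝ) = (⌈(N : ℝ) * x⌉ : ℝ) := by
    rw [Int.toNat_of_nonneg h0]
  exact_mod_cast this.symm

/-- uniform grid measure -/
def UN (N : ℕ) : Measure ℝ :=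
  ENNReal.ofReal (1 / (N + 1)) • ∑ j ∈ Finset.range (N + 1), Measure.dirac ((j : ℝ) / N)

def disc (N : ℕ) (μ : Measure ℝ) : Measure ℝ :=
  ENNReal.ofReal (1 - 1 / N) • μ.map (cN N) + ENNReal.ofReal (1 / N) • UN N

def gridS (N : ℕ) : Finset ℝ := (Finset.range (N + 1)).image fun j : ℕ => (j : ℝ) / N

lemma UN_prob (N : ℕ) : IsProbabilityMeasure (UN N) := by
  refine ⟨?_⟩
  unfold UN
  simp only [Measure.smul_apply, Measure.coe_finsetSum, Finset.sum_apply, measure_univ,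
    Finset.sum_const, Finset.card_range, smul_eq_mul, nsmul_eq_mul, mul_one]
  rw [show ((N + 1 : ℕ) : ENNReal) = ENNReal.ofReal ((N : ℝ) + 1) by
    rw [← Nat.cast_succ, ENNReal.ofReal_natCast], ← ENNReal.ofReal_mul (by positivity),
    one_div_mul_cancel (by positivity), ENNReal.ofReal_one]

lemma UN_compl (N : ℕ) : UN N (gridS N : Set ℝ)ᶜ = 0 := by
  unfold UN
  simp only [Measure.smul_apply, Measure.coe_finsetSum, Finset.sum_apply, smul_eq_mul]
  refine mul_eq_zero_of_right _ (Finset.sum_eq_zero fun j hj => ?_)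
  rw [Measure.dirac_apply' _ (Finset.measurableSet _).compl]
  simp only [indicator_apply_eq_zero, Pi.one_apply, one_ne_zero, imp_false, mem_compl_iff,
    not_not]
  exact Finset.mem_coe.2 (Finset.mem_image_of_mem _ hj)

lemma map_grid_compl {N : ℕ} (hN : 0 < N) {μ : Measure ℝ} (h : MemM μ) :
    μ.map (cN N) (gridS N : Set ℝ)ᶜ = 0 := by
  rw [Measure.map_apply (cN_meas N) (Finset.measurableSet _).compl]
  refine measure_mono_null (t := (Icc (0 : ℝ) 1)ᶜ) (fun x hx hx' => hx ?_) h.2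
  obtain ⟨j, hj, e⟩ := cN_mem hN hx'
  rw [e]
  exact Finset.mem_coe.2 (Finset.mem_image_of_mem (fun j : ℕ => (j : ℝ) / N) (by simp; omega))

lemma disc_compl {N : ℕ} (hN : 0 < N) {μ : Measure ℝ} (h : MemM μ) :
    disc N μ (gridS N : Set ℝ)ᶜ = 0 := by
  unfold disc
  simp [map_grid_compl hN h, UN_compl N]

lemma mem_gridS {N : ℕ} {x : ℝ} : x ∈ gridS N ↔ ∃ j : ℕ, j ≤ N ∧ (j : ℝ) / N = x := by
  simp [gridS, Nat.lt_succ_iff]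

lemma grid_sub (N : ℕ) : (gridS N : Set ℝ) ⊆ Icc 0 1 := by
  intro x hx
  obtain ⟨j, hj, rfl⟩ := mem_gridS.1 (Finset.mem_coe.1 hx)
  exact ⟨by positivity, div_le_one_of_le₀ (by exact_mod_cast hj) (by positivity)⟩

lemma one_div_N {N : ℕ} (hN : 0 < N) : 0 ≤ 1 - 1 / (N : ℝ) := by
  have : 1 / (N : ℝ) ≤ 1 := by
    rw [div_le_one (by exact_mod_cast hN)]; exact_mod_cast hN
  linarith

lemma disc_mem {N : ℕ} (hN : 0 < N) {μ : Measure ℝ} (h : MemM μ) : MemM (disc N μ) := by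
  have := h.1
  have := UN_prob N
  have : IsProbabilityMeasure (μ.map (cN N)) :=
    Measure.isProbabilityMeasure_map (cN_meas N).aemeasurable
  refine ⟨⟨?_⟩, measure_mono_null (compl_subset_compl.2 (grid_sub N)) (disc_compl hN h)⟩
  unfold disc
  simp only [Measure.add_apply, Measure.smul_apply, measure_univ, smul_eq_mul, mul_one]
  rw [← ENNReal.ofReal_add (one_div_N hN) (by positivity)]
  simp

lemma disc_fin {N : ℕ} (hN : 0 < N) {μ : Measure ℝ} (h : MemM μ) : FinSupp (disc N μ) :=
  ⟨gridS N, disc_compl hN h⟩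

lemma disc_atom {N : ℕ} (hN : 0 < N) (μ : Measure ℝ) {j : ℕ} (hj : j ≤ N) :
    disc N μ {(j : ℝ) / N} ≠ 0 := by
  unfold disc UN
  simp only [Measure.add_apply, Measure.smul_apply, Measure.coe_finsetSum, Finset.sum_apply,
    smul_eq_mul]
  refine fun h0 => ?_
  have h1 := (add_eq_zero.1 h0).2
  have hN' : (0 : ℝ) < N := by exact_mod_cast hN
  rw [mul_eq_zero, mul_eq_zero] at h1
  rcases h1 with h1 | h1 | h1
  · rw [ENNReal.ofReal_eq_zero] at h1
    have : 0 < 1 / (N : ℝ) := by positivity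
    linarith
  · rw [ENNReal.ofReal_eq_zero] at h1
    have : 0 < 1 / ((N : ℝ) + 1) := by positivity
    linarith
  · rw [Finset.sum_eq_zero_iff] at h1
    have := h1 j (by simp; omega)
    simp at this

lemma disc_nextPt {N : ℕ} (hN : 0 < N) {μ : Measure ℝ} (h : MemM μ) {j : ℕ} (hj : j < N) :
    nextPt (disc N μ) ((j : ℝ) / N) = ((j + 1 : ℕ) : ℝ) / N := by
  have hN' : (0 : ℝ) < N := by exact_mod_cast hN
  unfold nextPt
  refine IsLeast.csInf_eq ⟨Or.inl ⟨?_, ?_, disc_atom hN μ hj⟩, ?_⟩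
  · gcongr; exact_mod_cast Nat.lt_succ_self j
  · exact div_le_one_of_le₀ (by exact_mod_cast hj) hN'.le
  · rintro q (⟨h1, h2, h3⟩ | rfl)
    · have hq : q ∈ gridS N := by
        by_contra hq
        exact h3 (measure_mono_null (by simpa using hq) (disc_compl hN h))
      obtain ⟨i, hi, rfl⟩ := mem_gridS.1 hq
      have h4 : (j : ℝ) < i := by
        rwa [div_lt_div_iff_of_pos_right hN'] at h1
      gcongr
      exact_mod_cast h4
    · exact div_le_one_of_le₀ (by exact_mod_cast hj) hN'.le

lemma distF_disc {N : ℕ} (hN : 0 < N) {μ : Measure ℝ} (h : MemM μ) (s : ℝ) :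
    distF (disc N μ) s = (1 - 1 / N) * distF μ ((⌊(N : ℝ) * s⌋ : ℝ) / N)
      + 1 / N * distF (UN N) s := by
  have := h.1
  have := UN_prob N
  have : IsProbabilityMeasure (μ.map (cN N)) :=
    Measure.isProbabilityMeasure_map (cN_meas N).aemeasurable
  have e : μ.map (cN N) (Icc 0 s) = μ (Icc 0 ((⌊(N : ℝ) * s⌋ : ℝ) / N)) := by
    rw [Measure.map_apply (cN_meas N) measurableSet_Icc]
    apply measure_congr
    filter_upwards [h.ae] with x hx
    apply propext
    obtain ⟨j, hj, ej⟩ := cN_mem hN hx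
    change (0 ≤ cN N x ∧ cN N x ≤ s) ↔ (0 ≤ x ∧ x ≤ _)
    rw [cN_le hN, ej]
    exact ⟨fun h => ⟨hx.1, h.2⟩, fun h => ⟨by positivity, h.2⟩⟩
  unfold distF
  rw [← e]
  unfold disc
  simp only [Measure.add_apply, Measure.smul_apply, smul_eq_mul]
  rw [ENNReal.toReal_add (ENNReal.mul_ne_top ENNReal.ofReal_ne_top (measure_ne_top _ _))
    (ENNReal.mul_ne_top ENNReal.ofReal_ne_top (measure_ne_top _ _)), ENNReal.toReal_mul,
    ENNReal.toReal_mul, ENNReal.toReal_ofReal (one_div_N hN), ENNReal.toReal_ofReal (by positivity)]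

lemma distF_disc_grid {N : ℕ} (hN : 0 < N) {μ : Measure ℝ} (h : MemM μ) (j : ℕ) :
    distF (disc N μ) ((j : ℝ) / N) = (1 - 1 / N) * distF μ ((j : ℝ) / N)
      + 1 / N * distF (UN N) ((j : ℝ) / N) := by
  have hN' : (N : ℝ) ≠ 0 := by exact_mod_cast hN.ne'
  rw [distF_disc hN h, mul_div_cancel₀ _ hN']
  simp

lemma distF_disc_pos {N : ℕ} (hN : 0 < N) {μ : Measure ℝ} (h : MemM μ) {s : ℝ} (hs : 0 ≤ s) :
    0 < distF (disc N μ) s := by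
  have := (disc_mem hN h).1
  refine ENNReal.toReal_pos (fun h0 => ?_) (measure_ne_top _ _)
  refine disc_atom hN μ (Nat.zero_le N) (measure_mono_null ?_ h0)
  simpa using hs

lemma mix_mem {μ ν : Measure ℝ} (h : MemM μ) (h' : MemM ν) {l : ℝ} (hl : l ∈ Ioo (0 : ℝ) 1) :
    MemM (ENNReal.ofReal (1 - l) • μ + ENNReal.ofReal l • ν) := by
  have := h.1
  have := h'.1
  refine ⟨⟨?_⟩, ?_⟩
  · simp only [Measure.add_apply, Measure.smul_apply, measure_univ, smul_eq_mul, mul_one]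
    rw [← ENNReal.ofReal_add (by linarith [hl.2]) hl.1.le]
    simp
  · simp [h.2, h'.2]

lemma distF_mix {μ ν : Measure ℝ} (h : MemM μ) (h' : MemM ν) {l : ℝ} (hl : l ∈ Ioo (0 : ℝ) 1)
    (s : ℝ) : distF (ENNReal.ofReal (1 - l) • μ + ENNReal.ofReal l • ν) s =
      (1 - l) * distF μ s + l * distF ν s := by
  have := h.1
  have := h'.1
  unfold distF
  simp only [Measure.add_apply, Measure.smul_apply, smul_eq_mul]
  rw [ENNReal.toReal_add (ENNReal.mul_ne_top ENNReal.ofReal_ne_top (measure_ne_top _ _))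
    (ENNReal.mul_ne_top ENNReal.ofReal_ne_top (measure_ne_top _ _)), ENNReal.toReal_mul,
    ENNReal.toReal_mul, ENNReal.toReal_ofReal (by linarith [hl.2]), ENNReal.toReal_ofReal hl.1.le]

lemma dM_disc {μ : Measure ℝ} (h : MemM μ) :
    Tendsto (fun N : ℕ => dM μ (disc N μ)) atTop (nhds 0) := by
  have := h.1
  have hz : (0 : ℝ) = ∫ s in (0 : ℝ)..1, (0 : ℝ) := by simp
  rw [hz]
  unfold dM
  refine intervalIntegral.tendsto_integral_filter_of_dominated_convergence (fun _ => 1) ?_ ?_ ?_ ?_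
  · filter_upwards [eventually_gt_atTop 0] with N hN
    have := (disc_mem hN h).1
    exact ((distF_mono.measurable.sub distF_mono.measurable).abs).aestronglyMeasurable
  · filter_upwards [eventually_gt_atTop 0] with N hN
    refine Eventually.of_forall fun s _ => ?_
    have h1 := distF_le_one h s
    have h2 := distF_le_one (disc_mem hN h) s
    have h3 := distF_nonneg μ s
    have h4 := distF_nonneg (disc N μ) s
    rw [norm_eq_abs, abs_abs]
    exact abs_le.2 ⟨by linarith, by linarith⟩
  · simp
  · have hc : ∀ᵐ s ∂(volume : Measure ℝ), ContinuousAt (distF μ) s :=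
      ((distF_mono (μ := μ)).countable_not_continuousAt).ae_notMem volume |>.mono
        fun s hs => by simpa using hs
    filter_upwards [hc] with s hs _
    have hfl : Tendsto (fun N : ℕ => (⌊(N : ℝ) * s⌋ : ℝ) / N) atTop (nhds s) := by
      have hl : Tendsto (fun N : ℕ => s - 1 / (N : ℝ)) atTop (nhds s) := by
        simpa using (tendsto_const_nhds (x := s)).sub
          (tendsto_one_div_atTop_nhds_zero_nat (𝕜 := ℝ))
      refine tendsto_of_tendsto_of_tendsto_of_le_of_le' hl tendsto_const_nhds ?_ ?_
      · filter_upwards [eventually_gt_atTop 0] with N hN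
        have hN' : (0 : ℝ) < N := by exact_mod_cast hN
        rw [le_div_iff₀ hN', sub_mul, one_div, inv_mul_cancel₀ hN'.ne']
        linarith [Int.sub_one_lt_floor ((N : ℝ) * s)]
      · filter_upwards [eventually_gt_atTop 0] with N hN
        have hN' : (0 : ℝ) < N := by exact_mod_cast hN
        rw [div_le_iff₀ hN']
        linarith [Int.floor_le ((N : ℝ) * s)]
    have hinv : Tendsto (fun N : ℕ => 1 / (N : ℝ)) atTop (nhds 0) :=
      tendsto_one_div_atTop_nhds_zero_nat
    have hb : Tendsto (fun N : ℕ => 1 / (N : ℝ) * distF (UN N) s) atTop (nhds 0) := by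
      refine squeeze_zero (fun N => mul_nonneg (by positivity) (distF_nonneg _ _)) (fun N => ?_) hinv
      have := UN_prob N
      exact mul_le_of_le_one_right (by positivity) measureReal_le_one
    have hlim := (((tendsto_const_nhds (x := (1 : ℝ))).sub hinv).mul (hs.tendsto.comp hfl)).add hb
    have h2 : Tendsto (fun N : ℕ => distF (disc N μ) s) atTop (nhds (distF μ s)) := by
      simp only [sub_zero, one_mul, add_zero] at hlim
      refine hlim.congr' ?_
      filter_upwards [eventually_gt_atTop 0] with N hN
      rw [distF_disc hN h]
      rfl
    have h3 := ((tendsto_const_nhds (x := distF μ s)).sub h2).abs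
    simpa using h3




def mN (N : ℕ) (μ : Measure ℝ) (r : ℕ) : ℝ := distF (disc N μ) (((N - (r + 1) : ℕ) : ℝ) / N)

lemma FF_link {β : ℕ → ℝ} {Φ : ℝ → ℝ → ℝ} {N : ℕ} (hN : 0 < N) {μ : Measure ℝ} (h : MemM μ)
    (hΦ : IsAtomicSol β (disc N μ) Φ) (r : ℕ) (hr : r ≤ N) :
    Φ (((N - r : ℕ) : ℝ) / N) = FF (mN N μ) (gs β N) r := by
  have hN' : (0 : ℝ) < N := by exact_mod_cast hN
  induction r with
  | zero =>
    ext x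
    simp only [Nat.sub_zero, div_self hN'.ne']
    exact hΦ.1 x
  | succ r ih =>
    ext x
    have ih' := ih (by omega)
    have hj : N - (r + 1) < N := by omega
    have hmem : (((N - (r + 1) : ℕ) : ℝ) / N) ∈ Ico (0 : ℝ) 1 := by
      refine ⟨by positivity, ?_⟩
      rw [div_lt_one hN']
      exact_mod_cast hj
    have hm := distF_disc_pos hN h hmem.1
    rw [hΦ.2 _ hmem x, disc_nextPt hN h hj, gStep, if_neg hm.ne',
      show N - (r + 1) + 1 = N - r by omega, ih']
    rfl

lemma mN_mem {N : ℕ} (hN : 0 < N) {μ : Measure ℝ} (h : MemM μ) (r : ℕ) :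
    0 < mN N μ r ∧ mN N μ r ≤ 1 :=
  ⟨distF_disc_pos hN h (by positivity), distF_le_one (disc_mem hN h) _⟩

lemma mN_mix {N : ℕ} (hN : 0 < N) {μ ν : Measure ℝ} (h : MemM μ) (h' : MemM ν) {l : ℝ}
    (hl : l ∈ Ioo (0 : ℝ) 1) (r : ℕ) :
    mN N (ENNReal.ofReal (1 - l) • μ + ENNReal.ofReal l • ν) r =
      (1 - l) * mN N μ r + l * mN N ν r := by
  unfold mN
  rw [distF_disc_grid hN (mix_mem h h' hl), distF_disc_grid hN h, distF_disc_grid hN h',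
    distF_mix h h' hl]
  ring

lemma mN_sub {N : ℕ} (hN : 0 < N) {μ ν : Measure ℝ} (h : MemM μ) (h' : MemM ν) (r : ℕ) :
    mN N ν r - mN N μ r = (1 - 1 / N) * (distF ν (((N - (r + 1) : ℕ) : ℝ) / N)
      - distF μ (((N - (r + 1) : ℕ) : ℝ) / N)) := by
  unfold mN
  rw [distF_disc_grid hN h, distF_disc_grid hN h']
  ring

/-- reverse index of a point -/
lemma rev_idx {N : ℕ} (hN : 0 < N) {s : ℝ} (hs : s ∈ Icc (0 : ℝ) 1) :
    ⌊(N : ℝ) * (1 - s)⌋₊ ≤ N ∧ s ≤ ((N - ⌊(N : ℝ) * (1 - s)⌋₊ : ℕ) : ℝ) / N ∧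
      ((N - ⌊(N : ℝ) * (1 - s)⌋₊ : ℕ) : ℝ) / N ≤ s + 1 / N := by
  have hN' : (0 : ℝ) < N := by exact_mod_cast hN
  have h0 : 0 ≤ (N : ℝ) * (1 - s) := mul_nonneg hN'.le (by linarith [hs.2])
  have h1 := Nat.floor_le h0
  have h2 := Nat.lt_floor_add_one ((N : ℝ) * (1 - s))
  have h3 : ⌊(N : ℝ) * (1 - s)⌋₊ ≤ N := by
    have : (⌊(N : ℝ) * (1 - s)⌋₊ : ℝ) ≤ N := by nlinarith [hs.1]
    exact_mod_cast this
  refine ⟨h3, ?_, ?_⟩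
  · rw [Nat.cast_sub h3, le_div_iff₀ hN']
    linarith
  · rw [Nat.cast_sub h3, div_le_iff₀ hN', add_mul, one_div, inv_mul_cancel₀ hN'.ne']
    linarith

lemma rr_bound {β : ℕ → ℝ} (hβ : ValidBeta β) {s0 b ε : ℝ} (hs0 : 0 ≤ s0) (hb : s0 < b)
    (hb1 : b ≤ 1) (hε : 0 < ε) : ∃ η > 0, ∀ᶠ N : ℕ in atTop, ∀ a : ℕ → ℝ,
      (∀ i, s0 ≤ (((N - (i + 1) : ℕ) : ℝ) / N) → (((N - (i + 1) : ℕ) : ℝ) / N) < b →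
        ε * gs β N i ^ 2 ≤ a i) → η ≤ rr a (gs β N) N := by
  set w := (b - s0) / 10 with hw
  have hwp : 0 < w := by rw [hw]; linarith
  have hbw : b = s0 + 10 * w := by rw [hw]; ring
  set D := min (xiD β (s0 + 8 * w) - xiD β (s0 + 7 * w))
    (min (xiD β (s0 + 6 * w) - xiD β (s0 + 5 * w)) (xiD β (s0 + 4 * w) - xiD β (s0 + 3 * w)))
    with hD
  have hDp : 0 < D := by
    refine lt_min ?_ (lt_min ?_ ?_)
    all_goals exact sub_pos.2 (xiD_strict hβ (by linarith) (by linarith) (by linarith))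
  have hD1 : D ≤ xiD β (s0 + 8 * w) - xiD β (s0 + 7 * w) := min_le_left _ _
  have hD2 : D ≤ xiD β (s0 + 6 * w) - xiD β (s0 + 5 * w) :=
    (min_le_right _ _).trans (min_le_left _ _)
  have hD3 : D ≤ xiD β (s0 + 4 * w) - xiD β (s0 + 3 * w) :=
    (min_le_right _ _).trans (min_le_right _ _)
  refine ⟨(ε * D / 2) ^ 2 * D, by positivity, ?_⟩
  have hw' : ∀ᶠ N : ℕ in atTop, 1 / (N : ℝ) < w :=
    (tendsto_one_div_atTop_nhds_zero_nat (𝕜 := ℝ)).eventually (gt_mem_nhds hwp)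
  filter_upwards [eventually_gt_atTop 0, hw'] with N hN hNw a ha
  have hN' : (0 : ℝ) < N := by exact_mod_cast hN
  have key : ∀ k k' : ℝ, 0 ≤ k → k + 2 ≤ k' → k' ≤ 9 →
      D ≤ xiD β (s0 + k' * w) - xiD β (s0 + (k + 1) * w) →
      D ≤ tt (gs β N) ⌊(N : ℝ) * (1 - (s0 + k * w))⌋₊
        - tt (gs β N) ⌊(N : ℝ) * (1 - (s0 + k' * w))⌋₊ := by
    intro k k' hk hkk hk9 hDk
    have e1 := rev_idx hN (s := s0 + k * w) ⟨by positivity, by nlinarith⟩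
    have e2 := rev_idx hN (s := s0 + k' * w)
      ⟨add_nonneg hs0 (mul_nonneg (by linarith) hwp.le), by nlinarith⟩
    rw [tt_gs hβ hN, tt_gs hβ hN]
    have f1 := xiD_mono hβ (grid_mem N ⌊(N : ℝ) * (1 - (s0 + k * w))⌋₊).1
      (e1.2.2.trans (by linarith : _ ≤ s0 + (k + 1) * w)) (by nlinarith)
    have f2 := xiD_mono hβ (add_nonneg hs0 (mul_nonneg (by linarith) hwp.le)) e2.2.1
      (grid_mem N _).2
    linarith
  have mono : ∀ k k' : ℝ, k ≤ k' → ⌊(N : ℝ) * (1 - (s0 + k' * w))⌋₊ ≤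
      ⌊(N : ℝ) * (1 - (s0 + k * w))⌋₊ := by
    intro k k' hk
    refine Nat.floor_le_floor ?_
    have := mul_le_mul_of_nonneg_right hk hwp.le
    exact mul_le_mul_of_nonneg_left (by linarith) hN'.le
  refine rr_lower_pos (mono 6 8 (by norm_num)) (mono 4 6 (by norm_num)) (mono 2 4 (by norm_num))
    (rev_idx hN (s := s0 + 2 * w) ⟨by positivity, by linarith⟩).1 hε.le hDp.le ?_ ?_ ?_ ?_
  · intro i hi1 hi2
    have e1 := rev_idx hN (s := s0 + 2 * w) ⟨by positivity, by linarith⟩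
    have e2 := rev_idx hN (s := s0 + 8 * w) ⟨by positivity, by linarith⟩
    refine ha i ?_ ?_
    · have := grid_le N (Nat.succ_le_of_lt hi2)
      linarith [e1.2.1]
    · have := grid_le N (hi1.trans (Nat.le_succ i))
      linarith [e2.2.2]
  · exact key 6 8 (by norm_num) (by norm_num) (by norm_num) (by norm_num; exact hD1)
  · exact key 4 6 (by norm_num) (by norm_num) (by norm_num) (by norm_num; exact hD2)
  · exact key 2 4 (by norm_num) (by norm_num) (by norm_num) (by norm_num; exact hD3)

lemma exists_sep {μ ν : Measure ℝ} (h : MemM μ) (h' : MemM ν) {s0 : ℝ} (hs1 : s0 < 1)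
    (hlt : distF μ s0 < distF ν s0) :
    ∃ b ε, s0 < b ∧ b ≤ 1 ∧ 0 < ε ∧ ∀ s, s0 ≤ s → s < b → ε ≤ distF ν s - distF μ s := by
  have hc : ContinuousWithinAt (fun s => distF ν s - distF μ s) (Ici s0) s0 := by
    have e : (fun s => distF ν s - distF μ s) = fun s => cdf ν s - cdf μ s := by
      ext s; rw [distF_eq_cdf h, distF_eq_cdf h']
    rw [e]
    exact ((cdf ν).right_continuous s0).sub ((cdf μ).right_continuous s0)
  have hp : (distF ν s0 - distF μ s0) / 2 < distF ν s0 - distF μ s0 := by linarith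
  have hev := hc.eventually (lt_mem_nhds hp)
  obtain ⟨b, hb, hsub⟩ := mem_nhdsGE_iff_exists_Ico_subset.1 hev
  refine ⟨min b 1, (distF ν s0 - distF μ s0) / 2, lt_min hb hs1, min_le_right _ _, by linarith,
    fun s hs hsb => ?_⟩
  exact (hsub ⟨hs, hsb.trans_le (min_le_left _ _)⟩).le

lemma exists_distF_ne {μ ν : Measure ℝ} (h : MemM μ) (h' : MemM ν) (hne : μ ≠ ν) :
    ∃ s0, 0 ≤ s0 ∧ s0 < 1 ∧ distF μ s0 ≠ distF ν s0 := by
  by_contra! hcon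
  have := h.1
  have := h'.1
  apply hne
  apply Measure.eq_of_cdf
  ext s
  rw [← distF_eq_cdf h, ← distF_eq_cdf h']
  rcases lt_or_ge s 0 with hs | hs
  · simp [distF, Icc_eq_empty (not_le.2 hs)]
  · rcases lt_or_ge s 1 with hs1 | hs1
    · exact hcon s hs hs1
    · have key : ∀ ρ : Measure ℝ, MemM ρ → distF ρ s = 1 := by
        intro ρ hρ
        have := hρ.1
        have e : ρ (Icc 0 s) = 1 := by
          rw [← measure_univ (μ := ρ)]
          apply measure_congr
          filter_upwards [hρ.ae] with x hx
          apply propext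
          exact ⟨fun _ => trivial, fun _ => ⟨hx.1, hx.2.trans hs1⟩⟩
        simp [distF, e]
      rw [key μ h, key ν h']

lemma rr_final {β : ℕ → ℝ} (hβ : ValidBeta β) {μ ν : Measure ℝ} (h : MemM μ) (h' : MemM ν)
    {s0 : ℝ} (hs0 : 0 ≤ s0) (hs1 : s0 < 1) (hlt : distF μ s0 < distF ν s0) :
    ∃ η > 0, ∀ᶠ N : ℕ in atTop,
      η ≤ rr (fun i => (mN N ν i - mN N μ i) * gs β N i ^ 2) (gs β N) N := by
  obtain ⟨b, ε, hb, hb1, hε, hsep⟩ := exists_sep h h' hs1 hlt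
  obtain ⟨η, hη, hev⟩ := rr_bound hβ hs0 hb hb1 (half_pos hε)
  refine ⟨η, hη, ?_⟩
  filter_upwards [hev, eventually_ge_atTop 2] with N hN hN2
  refine hN _ fun i h1 h2 => ?_
  have h3 := hsep _ h1 h2
  rw [mN_sub (by omega) h h']
  have h4 : 1 / (N : ℝ) ≤ 1 / 2 := by
    have : (2 : ℝ) ≤ N := by exact_mod_cast hN2
    gcongr
  refine mul_le_mul_of_nonneg_right ?_ (sq_nonneg _)
  nlinarith

lemma rr_final_ne {β : ℕ → ℝ} (hβ : ValidBeta β) {μ ν : Measure ℝ} (h : MemM μ) (h' : MemM ν)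
    (hne : μ ≠ ν) : ∃ η > 0, ∀ᶠ N : ℕ in atTop,
      η ≤ rr (fun i => (mN N ν i - mN N μ i) * gs β N i ^ 2) (gs β N) N := by
  obtain ⟨s0, hs0, hs1, hd⟩ := exists_distF_ne h h' hne
  rcases lt_or_gt_of_ne hd with hlt | hlt
  · exact rr_final hβ h h' hs0 hs1 hlt
  · obtain ⟨η, hη, hev⟩ := rr_final hβ h' h hs0 hs1 hlt
    refine ⟨η, hη, hev.mono fun N hN => ?_⟩
    rw [← rr_neg] at hN
    convert hN using 3
    ring

lemma disc_close {β : ℕ → ℝ} {Φ : Measure ℝ → ℝ → ℝ → ℝ} (hΦ : IsParisiFamily β Φ) (x : ℝ)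
    {μ : Measure ℝ} (h : MemM μ) {ε : ℝ} (hε : 0 < ε) :
    ∀ᶠ N : ℕ in atTop, |Φ μ 0 x - Φ (disc N μ) 0 x| < ε := by
  obtain ⟨δ, hδ, hc⟩ := hΦ.2 μ h ε hε
  filter_upwards [(dM_disc h).eventually (gt_mem_nhds hδ), eventually_gt_atTop 0] with N hN hN0
  exact hc _ (disc_mem hN0 h) hN 0 ⟨le_rfl, zero_le_one⟩ x

lemma disc_val {β : ℕ → ℝ} {Φ : Measure ℝ → ℝ → ℝ → ℝ} (hΦ : IsParisiFamily β Φ) (x : ℝ)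
    {μ : Measure ℝ} (h : MemM μ) {N : ℕ} (hN : 0 < N) :
    Φ (disc N μ) 0 x = FF (mN N μ) (gs β N) N x := by
  have := FF_link hN h (hΦ.1 _ (disc_mem hN h) (disc_fin hN h)) N le_rfl
  rw [Nat.sub_self, Nat.cast_zero, zero_div] at this
  rw [this]

/-- **Strict convexity of the Parisi functional.** For every `h ∈ ℝ`, the Parisi
functional `μ ↦ Φ_μ(0,h)` is strictly convex on `𝓜`. -/
theorem stmt3 (β : ℕ → ℝ) (hβ : ValidBeta β)
    (Φ : Measure ℝ → ℝ → ℝ → ℝ) (hΦ : IsParisiFamily β Φ) (h : ℝ)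
    (μ₀ μ₁ : Measure ℝ) (h₀ : MemM μ₀) (h₁ : MemM μ₁) (hne : μ₀ ≠ μ₁)
    (l : ℝ) (hl : l ∈ Ioo (0 : ℝ) 1) :
    Φ (ENNReal.ofReal (1 - l) • μ₀ + ENNReal.ofReal l • μ₁) 0 h
      < (1 - l) * Φ μ₀ 0 h + l * Φ μ₁ 0 h := by
  obtain ⟨η, hη, hrr⟩ := rr_final_ne hβ h₀ h₁ hne
  have hM : 0 ≤ xiD β 1 := by
    have := xiD_mono hβ le_rfl zero_le_one le_rfl
    rwa [xiD_zero hβ] at this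
  obtain ⟨δ, hδ, sb, hsb, hgap⟩ := gap_unif hl.1 hl.2 hM h hη
  have hmix := mix_mem h₀ h₁ hl
  have hs : ∀ᶠ N : ℕ in atTop, sqrt (LL β / N) < sb := by
    have h1 : Tendsto (fun N : ℕ => sqrt (LL β / N)) atTop (nhds (sqrt 0)) :=
      (continuous_sqrt.tendsto 0).comp (tendsto_const_div_atTop_nhds_zero_nat (LL β))
    rw [sqrt_zero] at h1
    exact h1.eventually (gt_mem_nhds hsb)
  have hd4 : 0 < δ / 4 := by linarith
  obtain ⟨N, hN, hN0, hNs, c0, c1, cm⟩ := (hrr.and ((eventually_gt_atTop 0).and (hs.and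
    ((disc_close hΦ h h₀ hd4).and ((disc_close hΦ h h₁ hd4).and
      (disc_close hΦ h hmix hd4)))))).exists
  have g := hgap (mN N μ₀) (mN N μ₁) _ (gs β N) (mN_mem hN0 h₀) (mN_mem hN0 h₁)
    (mN_mix hN0 h₀ h₁ hl) (fun r => ⟨sqrt_nonneg _, (gs_le hβ hN0 r).trans hNs.le⟩)
    (tt_gs_le hβ hN0) N hN
  rw [← disc_val hΦ h h₀ hN0, ← disc_val hΦ h h₁ hN0, ← disc_val hΦ h hmix hN0] at g
  rw [abs_lt] at c0 c1 cm
  have hl0 := hl.1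
  have hl1 : 0 < 1 - l := by linarith [hl.2]
  have k0 := mul_lt_mul_of_pos_left c0.1 hl1
  have k1 := mul_lt_mul_of_pos_left c1.1 hl0
  nlinarith [cm.1, cm.2]


end
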